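/- arXiv:2605.01786 — 7 statements merged into one kernel-verified Lean document; each statement's English description precedes it below -/
import Mathlib

section
/- Let i, j ∈ {0, 1, …, p^m}. Then the cardinality of C_{i,j} equals: p^m − 2 if i = j = 0; 1 if i ≠ j and i·j ≠ 0; and 0 in the remaining cases (i.e., if i = j ≠ 0, or if i ≠ j and i·j = 0). -/
theorem aux_core (q : ℕ) (hq : 2 ≤ q) (K : Type) [Field K] [Fintype K]
    (hK : Fintype.card K = q ^ 2) (ψ : K) (hψ : ∀ x : K, x ≠ 0 → ∃ t : ℕ, ψ ^ t = x) :
    ψ ≠ 0 ∧ IsPrimitiveRoot ψ (q ^ 2 - 1) ∧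
    ∀ t i : ℕ, ((ψ ^ t) ^ q * ψ ^ i = ψ ^ t * (ψ ^ i) ^ q ↔ t % (q + 1) = i % (q + 1)) := by
  have h0 : ψ ≠ 0 := by
    rintro rfl
    have : Fintype.card K ≤ 2 := by
      classical
      have hs : (Finset.univ : Finset K) ⊆ {0, 1} := by
        intro x _
        by_cases hx : x = 0
        · simp [hx]
        · obtain ⟨t, ht⟩ := hψ x hx
          rcases Nat.eq_zero_or_pos t with h | h
          · subst h; simp at ht; simp [← ht]
          · rw [zero_pow (by omega)] at ht; exact absurd ht.symm hx
      calc Fintype.card K = (Finset.univ : Finset K).card := rfl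
        _ ≤ _ := Finset.card_le_card hs
        _ ≤ 2 := Finset.card_le_two
    nlinarith
  have hord : orderOf (Units.mk0 ψ h0) = q ^ 2 - 1 := by
    rw [orderOf_eq_card_of_forall_mem_zpowers, Nat.card_units, Nat.card_eq_fintype_card, hK]
    intro x
    obtain ⟨t, ht⟩ := hψ x x.ne_zero
    refine ⟨t, ?_⟩
    ext
    simpa using ht
  have hord' : orderOf ψ = q ^ 2 - 1 := by
    rw [← hord, ← orderOf_units]; rfl
  refine ⟨h0, ?_, ?_⟩
  · rw [← hord']; exact IsPrimitiveRoot.orderOf ψ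
  · intro t i
    have e : ((ψ ^ t) ^ q * ψ ^ i = ψ ^ t * (ψ ^ i) ^ q) ↔
        (Units.mk0 ψ h0) ^ (t * q + i) = (Units.mk0 ψ h0) ^ (t + i * q) := by
      rw [Units.ext_iff]
      simp [pow_add, pow_mul]
    rw [e, pow_eq_pow_iff_modEq, hord]
    change _ ↔ t ≡ i [MOD (q + 1)]
    rw [Nat.modEq_iff_dvd, Nat.modEq_iff_dvd]
    have h1 : ((q ^ 2 - 1 : ℕ) : ℤ) = ((q : ℤ) - 1) * (q + 1) := by
      rw [Nat.cast_sub (Nat.one_le_pow _ _ (by omega))]; push_cast; ring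
    have h2 : ((t + i * q : ℕ) : ℤ) - ((t * q + i : ℕ) : ℤ) = ((q : ℤ) - 1) * (i - t) := by
      push_cast; ring
    rw [h1, h2, mul_dvd_mul_iff_left (by omega)]
    push_cast; rfl

theorem aux_iff (q : ℕ) (hq : 2 ≤ q) (K : Type) [Field K] [Fintype K]
    (hK : Fintype.card K = q ^ 2) (ψ : K) (hψ : ∀ x : K, x ≠ 0 → ∃ t : ℕ, ψ ^ t = x)
    (i : ℕ) (hi : i ≤ q) (y : K) (hy : y ≠ 0) :
    (∃ t : ℕ, ψ ^ t = y ∧ t % (q + 1) = i) ↔ y ^ q * ψ ^ i = y * (ψ ^ i) ^ q := by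
  obtain ⟨h0, -, hc⟩ := aux_core q hq K hK ψ hψ
  have hi' : i % (q + 1) = i := Nat.mod_eq_of_lt (by omega)
  constructor
  · rintro ⟨t, rfl, ht⟩
    rw [hc, hi', ht]
  · intro h
    obtain ⟨t, rfl⟩ := hψ y hy
    refine ⟨t, rfl, ?_⟩
    rw [hc, hi'] at h
    exact h

theorem stmt_0 (p m : ℕ) (hp : p.Prime) (hm : 0 < m)
    (K : Type) [Field K] [Fintype K] (hK : Fintype.card K = p ^ (2 * m))
    (ψ : K) (hψ : ∀ x : K, x ≠ 0 → ∃ t : ℕ, ψ ^ t = x)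
    (i j : ℕ) (hi : i ≤ p ^ m) (hj : j ≤ p ^ m) :
    ((i = 0 ∧ j = 0) →
      Nat.card {x : K // x ≠ 0 ∧ x ≠ -1 ∧
        (∃ t : ℕ, ψ ^ t = x + 1 ∧ t % (p ^ m + 1) = i) ∧
        (∃ t : ℕ, ψ ^ t = x ∧ t % (p ^ m + 1) = j)} = p ^ m - 2) ∧
    ((i ≠ j ∧ i ≠ 0 ∧ j ≠ 0) →
      Nat.card {x : K // x ≠ 0 ∧ x ≠ -1 ∧
        (∃ t : ℕ, ψ ^ t = x + 1 ∧ t % (p ^ m + 1) = i) ∧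
        (∃ t : ℕ, ψ ^ t = x ∧ t % (p ^ m + 1) = j)} = 1) ∧
    (((i = j ∧ i ≠ 0) ∨ (i ≠ j ∧ (i = 0 ∨ j = 0))) →
      Nat.card {x : K // x ≠ 0 ∧ x ≠ -1 ∧
        (∃ t : ℕ, ψ ^ t = x + 1 ∧ t % (p ^ m + 1) = i) ∧
        (∃ t : ℕ, ψ ^ t = x ∧ t % (p ^ m + 1) = j)} = 0) := by
  classical
  have : Fact p.Prime := ⟨hp⟩
  have hchar : CharP K p := by
    obtain ⟨r, hr⟩ := CharP.exists K
    obtain ⟨n, hrp, hn⟩ := FiniteField.card K r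
    have : r = p := by
      have h1 : r ∣ p ^ (2 * m) := by
        rw [← hK, hn]; exact dvd_pow_self r n.ne_zero
      exact (Nat.prime_dvd_prime_iff_eq hrp hp).1 (hrp.dvd_of_dvd_pow h1)
    exact this ▸ hr
  have hadd : ∀ x y : K, (x + y) ^ (p ^ m) = x ^ (p ^ m) + y ^ (p ^ m) :=
    fun x y => add_pow_char_pow x y p m
  have hsub : ∀ x y : K, (x - y) ^ (p ^ m) = x ^ (p ^ m) - y ^ (p ^ m) :=
    fun x y => sub_pow_char_pow x y m
  have hq : 2 ≤ p ^ m := le_trans hp.two_le (Nat.le_self_pow (by omega) p)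
  have hK' : Fintype.card K = (p ^ m) ^ 2 := by rw [hK, ← pow_mul, mul_comm]
  clear hK hm
  generalize p ^ m = q at *
  obtain ⟨h0, hprim, hc⟩ := aux_core q hq K hK' ψ hψ
  have hinv : ∀ x : K, (x ^ q) ^ q = x := by
    intro x
    rw [← pow_mul, ← sq, ← hK', FiniteField.pow_card]
  have hset : ∀ x : K, (x ≠ 0 ∧ x ≠ -1 ∧
        (∃ t : ℕ, ψ ^ t = x + 1 ∧ t % (q + 1) = i) ∧
        (∃ t : ℕ, ψ ^ t = x ∧ t % (q + 1) = j)) ↔ (x ≠ 0 ∧ x ≠ -1 ∧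
        (x ^ q + 1) * ψ ^ i = (x + 1) * (ψ ^ i) ^ q ∧ x ^ q * ψ ^ j = x * (ψ ^ j) ^ q) := by
    intro x
    refine and_congr_right fun hx => and_congr_right fun hx1 => ?_
    have hx2 : x + 1 ≠ 0 := fun h => hx1 (eq_neg_of_add_eq_zero_left h)
    rw [aux_iff q hq K hK' ψ hψ i hi _ hx2, aux_iff q hq K hK' ψ hψ j hj _ hx, hadd, one_pow]
  simp_rw [hset]
  have hne : ∀ t, t ≤ q → t ≠ 0 → (ψ ^ t) ^ q ≠ ψ ^ t := by
    intro t ht ht0 h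
    have := (hc t 0).1 (by simpa using h)
    rw [Nat.mod_eq_of_lt (by omega), Nat.zero_mod] at this
    exact ht0 this
  refine ⟨?_, ?_, ?_⟩
  · rintro ⟨rfl, rfl⟩
    have hp1 : IsPrimitiveRoot (ψ ^ (q + 1)) (q - 1) := by
      refine hprim.pow ?_ ?_
      · have : 2 ^ 2 ≤ q ^ 2 := Nat.pow_le_pow_left hq 2
        omega
      · have := Nat.sq_sub_sq q 1
        simpa using this
    have hcard := hp1.card_nthRootsFinset
    have hpow : ∀ x : K, x ≠ 0 → (x ^ q = x ↔ x ^ (q - 1) = 1) := by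
      intro x hx
      obtain ⟨r, rfl⟩ : ∃ r, q = r + 1 := ⟨q - 1, by omega⟩
      rw [pow_succ, Nat.add_sub_cancel]
      exact mul_eq_right₀ hx
    have hm1 : (-1 : K) ^ q = -1 := by
      have := hsub 0 1
      rw [zero_pow (by omega)] at this
      simpa using this
    have hmem : (-1 : K) ∈ Polynomial.nthRootsFinset (q - 1) (1 : K) := by
      rw [Polynomial.mem_nthRootsFinset (by omega)]
      exact (hpow _ (by simp)).1 hm1
    have := Finset.card_erase_of_mem hmem
    rw [hcard] at this
    rw [show q - 2 = q - 1 - 1 by omega, ← this]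
    refine Nat.subtype_card _ ?_
    intro x
    rw [Finset.mem_erase, Polynomial.mem_nthRootsFinset (by omega)]
    constructor
    · rintro ⟨h1, h2⟩
      have hx : x ≠ 0 := by
        rintro rfl
        rw [zero_pow (by omega)] at h2
        exact zero_ne_one h2
      have := (hpow x hx).2 h2
      exact ⟨hx, h1, by simp [this], by simp [this]⟩
    · rintro ⟨hx, h1, -, h2⟩
      exact ⟨h1, (hpow x hx).1 (by simpa using h2)⟩
  · rintro ⟨hij, hi0, hj0⟩
    have hD : (ψ ^ j) ^ q * ψ ^ i ≠ ψ ^ j * (ψ ^ i) ^ q := by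
      intro h
      rw [hc, Nat.mod_eq_of_lt (by omega), Nat.mod_eq_of_lt (by omega)] at h
      exact hij h.symm
    have hu := hne i hi hi0
    have hv := hne j hj hj0
    have hv0 : ψ ^ j ≠ 0 := pow_ne_zero _ h0
    have hu0 : ψ ^ i ≠ 0 := pow_ne_zero _ h0
    have hu2 := hinv (ψ ^ i)
    have hv2 := hinv (ψ ^ j)
    generalize ψ ^ i = u at *
    generalize ψ ^ j = v at *
    have hD' : v ^ q * u - v * u ^ q ≠ 0 := sub_ne_zero.2 hD
    have hD2 : v * u ^ q - v ^ q * u ≠ 0 := sub_ne_zero.2 hD.symm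
    rw [Nat.card_eq_one_iff_unique]
    have hxq : ((u ^ q - u) / (v ^ q * u - v * u ^ q) * v) ^ q
        = (u ^ q - u) / (v ^ q * u - v * u ^ q) * v ^ q := by
      rw [mul_pow, div_pow, hsub, hsub, mul_pow, mul_pow, hu2, hv2]
      congr 1
      rw [div_eq_div_iff hD2 hD']
      ring
    constructor
    · constructor
      rintro ⟨x, hx0, hx1, hx2, hx3⟩ ⟨y, hy0, hy1, hy2, hy3⟩
      ext
      simp only
      have : (x - y) * (v ^ q * u - v * u ^ q) = 0 := by
        linear_combination v * hx2 - u * hx3 - v * hy2 + u * hy3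
      exact sub_eq_zero.1 ((mul_eq_zero.1 this).resolve_right hD')
    · refine ⟨⟨(u ^ q - u) / (v ^ q * u - v * u ^ q) * v, ?_, ?_, ?_, ?_⟩⟩
      · exact mul_ne_zero (div_ne_zero (sub_ne_zero.2 hu) hD') hv0
      · intro h
        rw [div_mul_eq_mul_div, div_eq_iff hD'] at h
        have : u * (v ^ q - v) = 0 := by linear_combination h
        exact (mul_ne_zero hu0 (sub_ne_zero.2 hv)) this
      · rw [hxq]
        have hb := div_mul_cancel₀ (u ^ q - u) hD'
        linear_combination hb
      · rw [hxq]; ring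
  · intro h
    rw [Nat.card_eq_zero]
    left
    constructor
    rintro ⟨x, hx0, hx1, hx2, hx3⟩
    have hx2' : x + 1 ≠ 0 := fun h => hx1 (eq_neg_of_add_eq_zero_left h)
    rcases h with ⟨rfl, h⟩ | ⟨hij, rfl | rfl⟩
    · exact hne i hi h (by linear_combination hx3 - hx2)
    · simp at hx2
      rw [hx2] at hx3
      exact hne j hj hij.symm (mul_left_cancel₀ hx0 hx3).symm
    · simp at hx3
      rw [hx3] at hx2
      exact hne i hi hij (mul_left_cancel₀ hx2' hx2).symm
end

section
/- The differential uniformity of F satisfies Δ_F = p^m + (s₁ − 1)(s₁ − 2) + (s₂ − 1)(s₂ − 2). -/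
/-- arithmetic -/
theorem nih_arith (q s1 s2 n1 n2 : ℕ) (h1 : n1 = 0 ∨ n1 = s1 ∧ 2 * s1 ≤ q + 1)
    (h2 : n2 = 0 ∨ n2 = s2 ∧ 2 * s2 ≤ q + 1) (h1p : 0 < s1) (h2p : 0 < s2)
    (h12 : n1 ≠ 0 → n2 ≠ 0 → 2 * (s1 * s2) ≤ q + 1) :
    (n1 * n1 - n1) + (n2 * n2 - n2) ≤ q + (s1 - 1) * (s1 - 2) + (s2 - 1) * (s2 - 2) := by
  have key : ∀ a : ℕ, 0 < a → a * a + 2 = (a - 1) * (a - 2) + 3 * a := by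
    intro a ha
    obtain _ | _ | a := a
    · omega
    · rfl
    · simp only [Nat.add_sub_cancel, Nat.add_assoc]
      norm_num
      ring
  have k1 := key s1 h1p
  have k2 := key s2 h2p
  generalize (s1 - 1) * (s1 - 2) = X1 at *
  generalize (s2 - 1) * (s2 - 2) = X2 at *
  rcases h1 with rfl | ⟨rfl, h1⟩ <;> rcases h2 with rfl | ⟨rfl, h2⟩
  · simp
  · generalize n2 * n2 = Y2 at *
    omega
  · generalize n1 * n1 = Y2 at *
    omega
  · have := h12 (by omega) (by omega)
    have h3 : n1 + n2 ≤ n1 * n2 + 1 := by nlinarith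
    generalize n1 * n1 = Y1 at *
    generalize n2 * n2 = Y2 at *
    generalize n1 * n2 = Y3 at *
    omega

theorem nih_card (K : Type) [Field K] [Fintype K] [DecidableEq K] (k : ℕ)
    (hk : k ∣ Fintype.card K - 1) (hk0 : 0 < k) :
    (Finset.univ.filter (fun x : K => x ^ k = 1)).card = k := by
  classical
  obtain ⟨g, hg⟩ := IsCyclic.exists_ofOrder_eq_natCard (α := Kˣ)
  rw [Nat.card_eq_fintype_card, Fintype.card_units] at hg
  have hpr : IsPrimitiveRoot (g : K) (Fintype.card K - 1) := by
    rw [← hg]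
    exact IsPrimitiveRoot.coe_units_iff.2 (IsPrimitiveRoot.orderOf g)
  obtain ⟨l, hl⟩ := hk
  have hc : 0 < Fintype.card K - 1 := by
    have := Fintype.one_lt_card (α := K)
    omega
  have hpr2 := hpr.pow hc (by rw [hl, mul_comm] : Fintype.card K - 1 = l * k)
  refine Eq.trans ?_ hpr2.card_nthRootsFinset
  congr 1
  ext x
  simp [Polynomial.mem_nthRootsFinset hk0]

open Classical in
noncomputable def nihP (K : Type) [Field K] [Fintype K] (q s : ℕ) (b : K) : Finset (K × K) :=
  Finset.univ.filter (fun z => z.1 ^ (q + 1) = 1 ∧ z.2 ^ (q + 1) = 1 ∧ z.1 ≠ 1 ∧ z.2 ≠ 1 ∧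
    z.1 ≠ z.2 ∧ (z.1 - 1) * z.2 ^ s - (z.2 - 1) * z.1 ^ s = b * (z.1 - z.2))

theorem nih_pow (K : Type) [Field K] (q s : ℕ) (x : K) :
    x ^ (s * (q - 1) + 1) = x * (x ^ (q - 1)) ^ s := by
  rw [pow_succ, mul_comm s, pow_mul, mul_comm]

theorem nih_fwd (K : Type) [Field K] [Fintype K] (q : ℕ) (hq : 2 ≤ q)
    (hK : Fintype.card K = q ^ 2) (σ : K →+* K) (hσ : ∀ x, σ x = x ^ q) (x : K)
    (hx : x ^ q ≠ x) :
    (x ^ (q - 1)) ^ (q + 1) = 1 ∧ ((x + 1) ^ (q - 1)) ^ (q + 1) = 1 ∧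
    x ^ (q - 1) ≠ 1 ∧ (x + 1) ^ (q - 1) ≠ 1 ∧ x ^ (q - 1) ≠ (x + 1) ^ (q - 1) ∧
    x * (x ^ (q - 1) - (x + 1) ^ (q - 1)) = (x + 1) ^ (q - 1) - 1 := by
  have h0 : x ≠ 0 := by
    rintro rfl
    exact hx (zero_pow (by omega))
  have hx1 : (x + 1) ^ q = x ^ q + 1 := by
    rw [← hσ, ← hσ, map_add, map_one]
  have h1 : x + 1 ≠ 0 := by
    intro h
    rw [h, zero_pow (by omega)] at hx1
    apply hx
    linear_combination -h - hx1
  have hu : ∀ y : K, y ≠ 0 → (y ^ (q - 1)) ^ (q + 1) = 1 := by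
    intro y hy
    rw [← pow_mul, ← FiniteField.pow_card_sub_one_eq_one y hy, hK]
    congr 1
    obtain ⟨r, rfl⟩ : ∃ r, q = r + 1 := ⟨q - 1, by omega⟩
    simp only [Nat.add_sub_cancel]
    have : (r + 1) ^ 2 = r * (r + 1 + 1) + 1 := by ring
    omega
  have e0 : x ^ q = x ^ (q - 1) * x := by rw [← pow_succ]; congr 1; omega
  have e1 : (x + 1) ^ q = (x + 1) ^ (q - 1) * (x + 1) := by rw [← pow_succ]; congr 1; omega
  have hA := hu x h0
  have hB := hu _ h1
  refine ⟨hA, hB, ?_⟩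
  clear hA hB
  generalize x ^ (q - 1) = u at *
  generalize (x + 1) ^ (q - 1) = v at *
  rw [e0] at hx1 hx
  rw [e1] at hx1
  have hlin : x * (u - v) = v - 1 := by linear_combination -hx1
  refine ⟨?_, ?_, ?_, hlin⟩
  · rintro rfl; exact hx (one_mul _)
  · rintro rfl
    apply hx
    linear_combination hlin
  · rintro rfl
    apply hx
    have : u = 1 := by linear_combination -hlin
    rw [this, one_mul]

theorem nih_bwd (K : Type) [Field K] [Fintype K] (q : ℕ) (hq : 2 ≤ q)
    (σ : K →+* K) (hσ : ∀ x, σ x = x ^ q) (u v : K)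
    (hu : u ^ (q + 1) = 1) (hv : v ^ (q + 1) = 1) (hu1 : u ≠ 1) (hv1 : v ≠ 1) (huv : u ≠ v)
    (x : K) (hx : x * (u - v) = v - 1) :
    x ^ (q - 1) = u ∧ (x + 1) ^ (q - 1) = v ∧ x ^ q ≠ x := by
  have hu0 : u ≠ 0 := by rintro rfl; simp at hu
  have hv0 : v ≠ 0 := by rintro rfl; simp at hv
  have huv' := sub_ne_zero.2 huv
  have h0 : x ≠ 0 := by
    rintro rfl
    apply hv1
    linear_combination -hx
  have hx1 : (x + 1) * (u - v) = u - 1 := by linear_combination hx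
  have h1 : x + 1 ≠ 0 := by
    intro h
    rw [h] at hx1
    apply hu1
    linear_combination -hx1
  have su : σ u * u = 1 := by rw [hσ, ← pow_succ, hu]
  have sv : σ v * v = 1 := by rw [hσ, ← pow_succ, hv]
  have hc := congrArg σ hx
  simp only [map_mul, map_sub, map_one] at hc
  have hxs : σ x = u * x := by
    apply mul_right_cancel₀ huv'
    linear_combination (-u*v)*hc - u * hx + σ x * v * su - σ x * u * sv - u * sv
  have e0 : x ^ q = x ^ (q - 1) * x := by rw [← pow_succ]; congr 1; omega
  have e1 : (x + 1) ^ q = (x + 1) ^ (q - 1) * (x + 1) := by rw [← pow_succ]; congr 1; omega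
  refine ⟨?_, ?_, ?_⟩
  · apply mul_right_cancel₀ h0
    rw [← e0, ← hσ, hxs]
  · apply mul_right_cancel₀ h1
    rw [← e1, ← hσ, map_add, map_one, hxs]
    linear_combination hx
  · rw [← hσ, hxs]
    intro h
    apply hu1
    exact mul_right_cancel₀ h0 (by rw [h, one_mul])

theorem nih_fwd_mem (K : Type) [Field K] [Fintype K] (q s : ℕ) (hq : 2 ≤ q)
    (hK : Fintype.card K = q ^ 2) (σ : K →+* K) (hσ : ∀ x, σ x = x ^ q) (b x : K)
    (hx : x ^ q ≠ x) (hb : (x + 1) ^ (s * (q - 1) + 1) - x ^ (s * (q - 1) + 1) = b) :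
    (x ^ (q - 1), (x + 1) ^ (q - 1)) ∈ nihP K q s b := by
  obtain ⟨h1, h2, h3, h4, h5, h6⟩ := nih_fwd K q hq hK σ hσ x hx
  simp only [nihP, Finset.mem_filter, Finset.mem_univ, true_and]
  refine ⟨h1, h2, h3, h4, h5, ?_⟩
  rw [nih_pow, nih_pow] at hb
  generalize x ^ (q - 1) = u at *
  generalize (x + 1) ^ (q - 1) = v at *
  linear_combination (u - v) * hb - (v^s - u^s) * h6

/-- counting the solutions outside the subfield -/
theorem nih_count (K : Type) [Field K] [Fintype K] [DecidableEq K] (q s : ℕ) (hq : 2 ≤ q)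
    (hK : Fintype.card K = q ^ 2) (σ : K →+* K) (hσ : ∀ x, σ x = x ^ q) (b : K) :
    (Finset.univ.filter (fun x : K => x ^ q ≠ x ∧
      (x + 1) ^ (s * (q - 1) + 1) - x ^ (s * (q - 1) + 1) = b)).card = (nihP K q s b).card := by
  apply Finset.card_bij (fun x _ => (x ^ (q - 1), (x + 1) ^ (q - 1)))
  · intro x hx
    simp only [Finset.mem_filter, Finset.mem_univ, true_and] at hx
    exact nih_fwd_mem K q s hq hK σ hσ b x hx.1 hx.2
  · intro x hx y hy hxy
    simp only [Finset.mem_filter, Finset.mem_univ, true_and] at hx hy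
    obtain ⟨h1, h2, h3, h4, h5, h6⟩ := nih_fwd K q hq hK σ hσ x hx.1
    obtain ⟨-, -, -, -, -, h6'⟩ := nih_fwd K q hq hK σ hσ y hy.1
    rw [Prod.mk.injEq] at hxy
    rw [← hxy.1, ← hxy.2, ← h6] at h6'
    exact (mul_right_cancel₀ (sub_ne_zero.2 h5) h6').symm
  · rintro ⟨u, v⟩ h
    simp only [nihP, Finset.mem_filter, Finset.mem_univ, true_and] at h
    obtain ⟨h1, h2, h3, h4, h5, h6⟩ := h
    have huv := sub_ne_zero.2 h5
    have hx : (v - 1) / (u - v) * (u - v) = v - 1 := div_mul_cancel₀ _ huv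
    generalize (v - 1) / (u - v) = x at hx
    obtain ⟨g1, g2, g3⟩ := nih_bwd K q hq σ hσ u v h1 h2 h3 h4 h5 x hx
    refine ⟨x, ?_, by rw [g1, g2]⟩
    simp only [Finset.mem_filter, Finset.mem_univ, true_and]
    refine ⟨g3, ?_⟩
    rw [nih_pow, nih_pow, g1, g2]
    apply mul_right_cancel₀ huv
    linear_combination h6 + (v ^ s - u ^ s) * hx

/-- the two key relations -/
theorem nih_rel (K : Type) [Field K] [Fintype K] (q t : ℕ)
    (σ : K →+* K) (hσ : ∀ x, σ x = x ^ q) (b u v : K)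
    (h : (u, v) ∈ nihP K q (t + 1) b) :
    u ^ t * (1 - σ b * (v ^ (t + 1))) = b - v ^ (t + 1) ∧
    v ^ t * (1 - σ b * (u ^ (t + 1))) = b - u ^ (t + 1) := by
  simp only [nihP, Finset.mem_filter, Finset.mem_univ, true_and] at h
  obtain ⟨h1, h2, h3, h4, h5, h6⟩ := h
  have huv := sub_ne_zero.2 h5
  have su : σ u * u = 1 := by rw [hσ, ← pow_succ, h1]
  have sv : σ v * v = 1 := by rw [hσ, ← pow_succ, h2]
  have sC : (σ u) ^ t * u ^ t = 1 := by rw [← mul_pow, su, one_pow]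
  have sD : (σ v) ^ t * v ^ t = 1 := by rw [← mul_pow, sv, one_pow]
  have hc := congrArg σ h6
  simp only [map_mul, map_sub, map_one, map_pow] at hc
  rw [pow_succ, pow_succ] at hc h6
  rw [pow_succ, pow_succ]
  have hu0 : u ≠ 0 := right_ne_zero_of_mul_eq_one su
  have hv0 : v ≠ 0 := right_ne_zero_of_mul_eq_one sv
  have hC0 := right_ne_zero_of_mul_eq_one sC
  have hD0 := right_ne_zero_of_mul_eq_one sD
  rw [eq_inv_of_mul_eq_one_left su, eq_inv_of_mul_eq_one_left sv] at hc
  rw [inv_pow, inv_pow] at hc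
  generalize u ^ t = C at *
  generalize v ^ t = D at *
  generalize σ b = c at *
  have hc' : (u - 1) * C - (v - 1) * D = c * (u - v) * (C * D) := by
    field_simp at hc
    linear_combination -hc
  constructor
  · apply mul_right_cancel₀ huv
    linear_combination h6 + v * hc'
  · apply mul_right_cancel₀ huv
    linear_combination h6 + u * hc'

theorem nih_mem_inter (K : Type) [Field K] [Fintype K] (q t : ℕ)
    (σ : K →+* K) (hσ : ∀ x, σ x = x ^ q) (b u v : K) (hb : b ^ (q + 1) = 1)
    (h : (u, v) ∈ nihP K q (t + 1) b) :
    (u ^ (t + 1) = b ∧ v ^ (t + 1) = b) ∨ (u ^ t = b ∧ v ^ t = b) := by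
  obtain ⟨r1, r2⟩ := nih_rel K q t σ hσ b u v h
  simp only [nihP, Finset.mem_filter, Finset.mem_univ, true_and] at h
  obtain ⟨h1, h2, h3, h4, h5, h6⟩ := h
  have sb : σ b * b = 1 := by rw [hσ, ← pow_succ, hb]
  have hb0 : b ≠ 0 := right_ne_zero_of_mul_eq_one sb
  have k1 : (u ^ t - b) * (v ^ (t + 1) - b) = 0 := by
    linear_combination (-b) * r1 - u ^ t * v ^ (t + 1) * sb
  have k2 : (v ^ t - b) * (u ^ (t + 1) - b) = 0 := by
    linear_combination (-b) * r2 - v ^ t * u ^ (t + 1) * sb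
  have aux : ∀ w : K, w ≠ 1 → w ^ t = b → w ^ (t + 1) = b → False := by
    intro w hw e1 e2
    rw [pow_succ, e1] at e2
    exact hw (mul_left_cancel₀ hb0 (by rw [e2, mul_one]))
  rcases mul_eq_zero.1 k1 with k1 | k1 <;> rcases mul_eq_zero.1 k2 with k2 | k2 <;>
    rw [sub_eq_zero] at k1 k2
  · exact Or.inr ⟨k1, k2⟩
  · exact (aux u h3 k1 k2).elim
  · exact (aux v h4 k2 k1).elim
  · exact Or.inl ⟨k2, k1⟩

open Classical in
noncomputable def nihS (K : Type) [Field K] [Fintype K] (q k : ℕ) (b : K) : Finset K :=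
  Finset.univ.filter (fun u => u ^ (q + 1) = 1 ∧ u ^ k = b)

theorem nih_dvd (q : ℕ) : q + 1 ∣ q ^ 2 - 1 := by
  have := Nat.sq_sub_sq q 1
  rw [one_pow] at this
  rw [this]
  exact dvd_mul_right _ _

theorem nih_S_one (K : Type) [Field K] [Fintype K] (q k : ℕ) (hK : Fintype.card K = q ^ 2) :
    (nihS K q k 1).card = Nat.gcd k (q + 1) := by
  classical
  have := nih_card K (Nat.gcd k (q + 1)) (by
    rw [hK]; exact (Nat.gcd_dvd_right _ _).trans (nih_dvd q)) (Nat.gcd_pos_of_pos_right _ (by omega))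
  refine Eq.trans ?_ this
  congr 1
  ext x
  simp only [nihS, Finset.mem_filter, Finset.mem_univ, true_and, pow_gcd_eq_one]
  tauto

theorem nih_S (K : Type) [Field K] [Fintype K] (q k : ℕ) (hK : Fintype.card K = q ^ 2)
    (b c : K) (hc : c ^ (q + 1) = 1) (hcb : c ^ k = b) :
    (nihS K q k b).card = Nat.gcd k (q + 1) := by
  classical
  rw [← nih_S_one K q k hK]
  have hc0 : c ≠ 0 := by rintro rfl; simp at hc
  have hb0 : b ≠ 0 := by rw [← hcb]; exact pow_ne_zero _ hc0
  apply Finset.card_bij (fun x _ => x / c)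
  · intro x hx
    simp only [nihS, Finset.mem_filter, Finset.mem_univ, true_and] at hx ⊢
    rw [div_pow, div_pow, hx.1, hx.2, hc, hcb, div_one, div_self hb0]
    exact ⟨rfl, rfl⟩
  · intro x _ y _ h
    exact (div_left_inj' hc0).1 h
  · intro y hy
    simp only [nihS, Finset.mem_filter, Finset.mem_univ, true_and] at hy
    refine ⟨y * c, ?_, mul_div_cancel_right₀ _ hc0⟩
    simp only [nihS, Finset.mem_filter, Finset.mem_univ, true_and]
    rw [mul_pow, mul_pow, hy.1, hy.2, hc, hcb, one_mul, one_mul]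
    exact ⟨rfl, rfl⟩

theorem nih_half (a n : ℕ) (h : a ∣ n) (hn : 0 < n) (hne : a ≠ n) : 2 * a ≤ n := by
  obtain ⟨c, rfl⟩ := h
  rcases c with _ | _ | c
  · simp at hn
  · simp at hne
  · nlinarith

theorem nih_S_cases (K : Type) [Field K] [Fintype K] (q k : ℕ) (hK : Fintype.card K = q ^ 2)
    (b : K) (hb1 : b ≠ 1) :
    (nihS K q k b).card = 0 ∨ ((nihS K q k b).card = Nat.gcd k (q + 1) ∧
      2 * Nat.gcd k (q + 1) ≤ q + 1) := by
  rcases (nihS K q k b).eq_empty_or_nonempty with h | ⟨c, hc⟩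
  · left; simp [h]
  · right
    simp only [nihS, Finset.mem_filter, Finset.mem_univ, true_and] at hc
    refine ⟨nih_S K q k hK b c hc.1 hc.2, nih_half _ _ (Nat.gcd_dvd_right _ _) (by omega) ?_⟩
    intro h
    apply hb1
    rw [← hc.2]
    exact (pow_gcd_eq_one.1 (by rw [h]; exact hc.1 : c ^ Nat.gcd k (q + 1) = 1)).1

theorem nih_cop (q t : ℕ) : Nat.Coprime (Nat.gcd (t + 1) (q + 1)) (Nat.gcd t (q + 1)) := by
  have : Nat.Coprime (t + 1) t := by simp
  exact (this.coprime_dvd_left (Nat.gcd_dvd_left _ _)).coprime_dvd_right (Nat.gcd_dvd_left _ _)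

/-- bound for `b` in the unit circle -/
theorem nih_bound1 (K : Type) [Field K] [Fintype K] (q t : ℕ) (hK : Fintype.card K = q ^ 2)
    (σ : K →+* K) (hσ : ∀ x, σ x = x ^ q) (b : K) (hb : b ^ (q + 1) = 1) (hb1 : b ≠ 1) :
    (nihP K q (t + 1) b).card ≤ q
        + (Nat.gcd (t + 1) (q + 1) - 1) * (Nat.gcd (t + 1) (q + 1) - 2)
        + (Nat.gcd t (q + 1) - 1) * (Nat.gcd t (q + 1) - 2) := by
  classical
  have hsub : nihP K q (t + 1) b ⊆
      (nihS K q (t + 1) b).offDiag ∪ (nihS K q t b).offDiag := by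
    rintro ⟨u, v⟩ h
    have h' := nih_mem_inter K q t σ hσ b u v hb h
    simp only [nihP, Finset.mem_filter, Finset.mem_univ, true_and] at h
    simp only [nihS, Finset.mem_union, Finset.mem_offDiag, Finset.mem_filter, Finset.mem_univ,
      true_and]
    tauto
  refine (Finset.card_le_card hsub).trans ((Finset.card_union_le _ _).trans ?_)
  rw [Finset.offDiag_card, Finset.offDiag_card]
  have hcop := nih_cop q t
  have d12 : Nat.gcd (t + 1) (q + 1) * Nat.gcd t (q + 1) ∣ q + 1 :=
    hcop.mul_dvd_of_dvd_of_dvd (Nat.gcd_dvd_right _ _) (Nat.gcd_dvd_right _ _)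
  refine nih_arith q _ _ _ _ (nih_S_cases K q (t + 1) hK b hb1) (nih_S_cases K q t hK b hb1)
    (Nat.gcd_pos_of_pos_right _ (by omega)) (Nat.gcd_pos_of_pos_right _ (by omega)) ?_
  intro n1 n2
  refine nih_half _ _ d12 (by omega) ?_
  intro heq
  obtain ⟨c, hc⟩ := Finset.card_ne_zero.1 n1
  obtain ⟨e, he⟩ := Finset.card_ne_zero.1 n2
  simp only [nihS, Finset.mem_filter, Finset.mem_univ, true_and] at hc he
  apply hb1
  have p1 : b ^ Nat.gcd t (q + 1) = 1 := by
    rw [← hc.2, ← pow_mul]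
    obtain ⟨w, hw⟩ := Nat.gcd_dvd_left (t + 1) (q + 1)
    rw [show (t + 1) * Nat.gcd t (q + 1) = (q + 1) * w by
      calc _ = (Nat.gcd (t + 1) (q + 1) * w) * Nat.gcd t (q + 1) := by rw [← hw]
        _ = (Nat.gcd (t + 1) (q + 1) * Nat.gcd t (q + 1)) * w := by ac_rfl
        _ = _ := by rw [heq], pow_mul, hc.1, one_pow]
  have p2 : b ^ Nat.gcd (t + 1) (q + 1) = 1 := by
    rw [← he.2, ← pow_mul]
    obtain ⟨w, hw⟩ := Nat.gcd_dvd_left t (q + 1)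
    rw [show t * Nat.gcd (t + 1) (q + 1) = (q + 1) * w by
      calc _ = (Nat.gcd t (q + 1) * w) * Nat.gcd (t + 1) (q + 1) := by rw [← hw]
        _ = (Nat.gcd (t + 1) (q + 1) * Nat.gcd t (q + 1)) * w := by ac_rfl
        _ = _ := by rw [heq], pow_mul, he.1, one_pow]
  have := pow_gcd_eq_one.2 ⟨p2, p1⟩
  rwa [hcop.gcd_eq_one, pow_one] at this

/-- bound for `b` off the unit circle -/
theorem nih_bound2 (K : Type) [Field K] [Fintype K] (q t : ℕ) (hK : Fintype.card K = q ^ 2)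
    (σ : K →+* K) (hσ : ∀ x, σ x = x ^ q) (b : K) (hb : b ^ (q + 1) ≠ 1) :
    (nihP K q (t + 1) b).card ≤ q := by
  classical
  have hU : (nihS K q 0 1).card = q + 1 := by rw [nih_S_one K q 0 hK, Nat.gcd_zero_left]
  have h1 : (1 : K) ∈ nihS K q 0 1 := by simp [nihS]
  have hE : ((nihS K q 0 1).erase 1).card = q := by
    rw [Finset.card_erase_of_mem h1, hU]; rfl
  refine le_of_le_of_eq ?_ hE
  apply Finset.card_le_card_of_injOn Prod.fst
  · rintro ⟨u, v⟩ h
    simp only [nihP, Finset.coe_filter, Finset.mem_univ, true_and, Set.mem_setOf_eq] at h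
    simp only [nihS, Finset.coe_erase, Finset.coe_filter, Set.mem_diff, Set.mem_setOf_eq,
      Finset.mem_univ, true_and, pow_zero, and_true, Set.mem_singleton_iff]
    exact ⟨h.1, h.2.2.1⟩
  · rintro ⟨u, v⟩ h ⟨u', v'⟩ h' huu
    simp only at huu
    subst huu
    rw [Finset.mem_coe] at h h'
    obtain ⟨r1, r2⟩ := nih_rel K q t σ hσ b u v h
    obtain ⟨r1', r2'⟩ := nih_rel K q t σ hσ b u v' h'
    simp only [nihP, Finset.mem_filter, Finset.mem_univ, true_and] at h h'
    have hU : ∀ w : K, w ^ (q + 1) = 1 → ∀ j, (w ^ j) ^ (q + 1) = 1 := by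
      intro w hw j
      rw [← pow_mul, mul_comm, pow_mul, hw, one_pow]
    have hne : ∀ j, u ^ j ≠ b := by
      rintro j rfl
      exact hb (hU u h.1 j)
    have hz : 1 - σ b * u ^ (t + 1) ≠ 0 := by
      intro hz
      rw [hz, mul_zero] at r2
      exact hne (t + 1) (sub_eq_zero.1 r2.symm).symm
    have hD : v ^ t = v' ^ t := mul_right_cancel₀ hz (r2.trans r2'.symm)
    have hv0 : v ≠ 0 := by rintro rfl; simp at h
    have hD0 : v ^ t ≠ 0 := pow_ne_zero _ hv0
    have hz2 : u ^ t * σ b - 1 ≠ 0 := by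
      intro hz2
      apply hne t
      linear_combination r1 + v ^ (t + 1) * hz2
    rw [pow_succ] at r1 r1'
    rw [← hD] at r1'
    have : v = v' := by
      apply mul_left_cancel₀ (mul_ne_zero hz2 hD0)
      linear_combination r1' - r1
    rw [this]

theorem nih_exact (K : Type) [Field K] [Fintype K] (q t : ℕ) (hK : Fintype.card K = q ^ 2)
    (σ : K →+* K) (hσ : ∀ x, σ x = x ^ q) :
    (nihP K q (t + 1) 1).card =
        (Nat.gcd (t + 1) (q + 1) - 1) * (Nat.gcd (t + 1) (q + 1) - 2)
        + (Nat.gcd t (q + 1) - 1) * (Nat.gcd t (q + 1) - 2) := by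
  classical
  have hP : nihP K q (t + 1) 1 =
      ((nihS K q (t + 1) 1).erase 1).offDiag ∪ ((nihS K q t 1).erase 1).offDiag := by
    ext ⟨u, v⟩
    constructor
    · intro h
      have h' := nih_mem_inter K q t σ hσ 1 u v (one_pow _) h
      simp only [nihP, Finset.mem_filter, Finset.mem_univ, true_and] at h
      simp only [nihS, Finset.mem_union, Finset.mem_offDiag, Finset.mem_filter, Finset.mem_univ,
        true_and, Finset.mem_erase]
      tauto
    · intro h
      simp only [nihS, Finset.mem_union, Finset.mem_offDiag, Finset.mem_filter, Finset.mem_univ,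
        true_and, Finset.mem_erase] at h
      simp only [nihP, Finset.mem_filter, Finset.mem_univ, true_and]
      rcases h with ⟨⟨a1, a2, a3⟩, ⟨b1, b2, b3⟩, c⟩ | ⟨⟨a1, a2, a3⟩, ⟨b1, b2, b3⟩, c⟩
      · refine ⟨a2, b2, a1, b1, c, ?_⟩
        rw [a3, b3]; ring
      · refine ⟨a2, b2, a1, b1, c, ?_⟩
        rw [pow_succ, pow_succ, a3, b3]; ring
  have hdis : Disjoint ((nihS K q (t + 1) 1).erase 1).offDiag ((nihS K q t 1).erase 1).offDiag := by
    rw [Finset.disjoint_left]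
    rintro ⟨u, v⟩ h h'
    simp only [nihS, Finset.mem_offDiag, Finset.mem_filter, Finset.mem_univ,
        true_and, Finset.mem_erase] at h h'
    have e := h.1.2.2
    rw [pow_succ, h'.1.2.2, one_mul] at e
    exact h.1.1 e
  have hc : ∀ k, ((nihS K q k 1).erase 1).card = Nat.gcd k (q + 1) - 1 := by
    intro k
    rw [Finset.card_erase_of_mem (by simp [nihS]), nih_S_one K q k hK]
  have ha : ∀ n : ℕ, (n - 1) * (n - 1) - (n - 1) = (n - 1) * (n - 2) := by
    intro n
    rw [show n - 2 = n - 1 - 1 by omega, Nat.mul_sub (n - 1) (n - 1) 1, mul_one]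
  rw [hP, Finset.card_union_of_disjoint hdis, Finset.offDiag_card, Finset.offDiag_card, hc, hc,
    ha, ha]

theorem nih_sub (K : Type) [Field K] [Fintype K] [DecidableEq K] (q : ℕ) (hq : 2 ≤ q)
    (hK : Fintype.card K = q ^ 2) :
    (Finset.univ.filter (fun x : K => x ^ q = x)).card = q := by
  have h1 := nih_card K (q - 1) (by
    rw [hK]
    have := Nat.sq_sub_sq q 1
    rw [one_pow] at this
    rw [this]
    exact dvd_mul_left _ _) (by omega)
  have : (Finset.univ.filter (fun x : K => x ^ q = x)) =
      insert 0 (Finset.univ.filter (fun x : K => x ^ (q - 1) = 1)) := by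
    ext x
    simp only [Finset.mem_filter, Finset.mem_univ, true_and, Finset.mem_insert]
    have e0 : x ^ q = x ^ (q - 1) * x := by rw [← pow_succ]; congr 1; omega
    rw [e0]
    by_cases hx : x = 0
    · simp [hx]
    · simp [hx]
  rw [this, Finset.card_insert_of_notMem, h1]
  · omega
  · simp only [Finset.mem_filter, Finset.mem_univ, true_and]
    rw [zero_pow (by omega)]
    exact zero_ne_one

theorem nih_subfield (K : Type) [Field K] (q s : ℕ) (hq : 2 ≤ q)
    (x : K) (hx : x ^ q = x) : x ^ (s * (q - 1) + 1) = x := by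
  rw [nih_pow]
  have e0 : x ^ q = x ^ (q - 1) * x := by rw [← pow_succ]; congr 1; omega
  by_cases h : x = 0
  · simp [h]
  · rw [e0] at hx
    rw [mul_right_cancel₀ h (hx.trans (one_mul x).symm), one_pow, mul_one]


/-- the differential uniformity of the Niho power function
`F(x) = x^(s(p^m-1)+1)` over `K = GF(p^(2m))` equals
`p^m + (s₁-1)(s₁-2) + (s₂-1)(s₂-2)` where `s₁ = gcd(s, p^m+1)`,
`s₂ = gcd(s-1, p^m+1)`.  The differential uniformity is the maximum over
`b ∈ K` of `Δ_F(1,b) = #{x : (x+1)^d - x^d = b}`. -/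
theorem stmt_1 (p m s : ℕ) (hp : p.Prime) (hm : 0 < m) (hs : 0 < s)
    (K : Type) [Field K] [Fintype K] (hK : Fintype.card K = p ^ (2 * m))
    (d : ℕ) (hd : d = s * (p ^ m - 1) + 1) :
    sSup {k : ℕ | ∃ b : K,
        Nat.card {x : K // (x + 1) ^ d - x ^ d = b} = k}
      = p ^ m
        + (Nat.gcd s (p ^ m + 1) - 1) * (Nat.gcd s (p ^ m + 1) - 2)
        + (Nat.gcd (s - 1) (p ^ m + 1) - 1) * (Nat.gcd (s - 1) (p ^ m + 1) - 2) := by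
  classical
  obtain ⟨t, rfl⟩ : ∃ t, s = t + 1 := ⟨s - 1, by omega⟩
  subst hd
  rw [Nat.add_sub_cancel]
  have hq : 2 ≤ p ^ m := hp.two_le.trans (Nat.le_self_pow hm.ne' p)
  have hK' : Fintype.card K = (p ^ m) ^ 2 := by rw [hK, ← pow_mul, mul_comm m]
  haveI : Fact p.Prime := ⟨hp⟩
  haveI : CharP K p := by
    obtain ⟨r, hr⟩ := CharP.exists K
    obtain ⟨n, hrp, hn⟩ := FiniteField.card K r
    have : r = p := by
      have h : r ∣ p ^ (2 * m) := by
        rw [← hK, hn]; exact dvd_pow_self r n.ne_zero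
      exact (Nat.prime_dvd_prime_iff_eq hrp hp).1 (hrp.dvd_of_dvd_pow h)
    rwa [← this]
  obtain ⟨σ, hσ⟩ : ∃ σ : K →+* K, ∀ x, σ x = x ^ (p ^ m) :=
    ⟨iterateFrobenius K p m, fun x => iterateFrobenius_def p m x⟩
  clear hK
  generalize p ^ m = q at *
  have hsf : ∀ x : K, x ^ q = x →
      (x + 1) ^ ((t + 1) * (q - 1) + 1) - x ^ ((t + 1) * (q - 1) + 1) = 1 := by
    intro x hx
    rw [nih_subfield K q (t + 1) hq x hx, nih_subfield K q (t + 1) hq (x + 1)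
      (by rw [← hσ, map_add, map_one, hσ, hx])]
    ring
  have hcard : ∀ b : K,
      Nat.card {x : K // (x + 1) ^ ((t + 1) * (q - 1) + 1) - x ^ ((t + 1) * (q - 1) + 1) = b} =
      (if b = 1 then q else 0) + (nihP K q (t + 1) b).card := by
    intro b
    rw [Nat.card_eq_fintype_card, Fintype.card_subtype, ← nih_count K q (t + 1) hq hK' σ hσ b,
      ← Finset.card_filter_add_card_filter_not (fun x : K => x ^ q = x), Finset.filter_filter,
      Finset.filter_filter]
    congr 1
    · split_ifs with hb
      · refine Eq.trans ?_ (nih_sub K q hq hK')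
        congr 1
        ext x
        simp only [Finset.mem_filter, Finset.mem_univ, true_and]
        exact ⟨fun h => h.2, fun h => ⟨by rw [hb]; exact hsf x h, h⟩⟩
      · rw [Finset.card_eq_zero, Finset.filter_eq_empty_iff]
        rintro x - ⟨h1, h2⟩
        exact hb (h1.symm.trans (hsf x h2))
    · congr 1
      ext x
      simp only [Finset.mem_filter, Finset.mem_univ, true_and]
      tauto
  apply IsGreatest.csSup_eq
  constructor
  · refine ⟨1, ?_⟩
    rw [hcard, if_pos rfl, nih_exact K q t hK' σ hσ, add_assoc]
  · rintro k ⟨b, rfl⟩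
    rw [hcard]
    by_cases hb1 : b = 1
    · subst hb1
      rw [if_pos rfl, nih_exact K q t hK' σ hσ, add_assoc]
    · rw [if_neg hb1, zero_add]
      by_cases hb : b ^ (q + 1) = 1
      · exact nih_bound1 K q t hK' σ hσ b hb hb1
      · have := nih_bound2 K q t hK' σ hσ b hb
        omega
end

section
/- The equation (x+1)^d − x^d = 1 has exactly p^m + (s₁ − 1)(s₁ − 2) + (s₂ − 1)(s₂ − 2) solutions x in K; that is, Δ_F(1,1) = p^m + (s₁ − 1)(s₁ − 2) + (s₂ − 1)(s₂ − 2). -/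
theorem aux_core_s3 {K : Type} [Field K] (u v A B : K) (hu : u ≠ 1) (hv : v ≠ 1) (huv : u ≠ v)
    (h1 : (u - 1) * B - (v - 1) * A = u - v)
    (h2 : (u - 1) * v * A - (v - 1) * u * B = (u - v) * (A * B)) :
    (A = 1 ∧ B = 1) ∨ (A = u ∧ B = v) := by
  have hu' : u - 1 ≠ 0 := sub_ne_zero.2 hu
  have hv' : v - 1 ≠ 0 := sub_ne_zero.2 hv
  have huv' : u - v ≠ 0 := sub_ne_zero.2 huv
  obtain ⟨t, ht⟩ : ∃ t, A = 1 + (u - 1) * t := ⟨(A - 1) / (u - 1), by field_simp; ring⟩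
  have hB : B = 1 + (v - 1) * t := by
    apply mul_left_cancel₀ hu'
    rw [ht] at h1
    linear_combination h1
  have : (u - 1) * (v - 1) * (u - v) * (t * (t - 1)) = 0 := by
    rw [hB, ht] at h2
    linear_combination -h2
  have h3 : t * (t - 1) = 0 := by
    rcases mul_eq_zero.1 this with h | h
    · exact absurd h (mul_ne_zero (mul_ne_zero hu' hv') huv')
    · exact h
  rcases mul_eq_zero.1 h3 with h | h
  · left; rw [ht, hB, h]; simp
  · right
    have : t = 1 := by linear_combination h
    rw [ht, hB, this]; constructor <;> ring

theorem aux_roots {K : Type} [Field K] [Fintype K] [DecidableEq K] (n : ℕ) (hn : n ∣ Fintype.card K - 1) :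
    (Finset.univ.filter (fun x : K => x ^ n = 1)).card = n := by
  obtain ⟨g, hg⟩ := IsCyclic.exists_ofOrder_eq_natCard (α := Kˣ)
  have hc : Nat.card Kˣ = Fintype.card K - 1 := by
    rw [Nat.card_eq_fintype_card, Fintype.card_units]
  have hpos : 0 < Fintype.card K - 1 := by
    have := Fintype.one_lt_card (α := K); omega
  have hn0 : 0 < n := Nat.pos_of_dvd_of_pos hn hpos
  have hprim : IsPrimitiveRoot (g : K) (Fintype.card K - 1) := by
    rw [← hc, ← hg]
    exact (IsPrimitiveRoot.coe_units_iff).2 (IsPrimitiveRoot.orderOf g)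
  obtain ⟨c, hc'⟩ := hn
  have := (hprim.pow hpos (hc'.trans (mul_comm _ _))).card_nthRootsFinset
  refine Eq.trans ?_ this
  congr 1
  ext x
  simp [Polynomial.mem_nthRootsFinset hn0]

theorem aux_T {K : Type} [Field K] [Fintype K] [DecidableEq K] (q k : ℕ) (hq : 1 < q)
    (hK : Fintype.card K = q ^ 2) :
    (((Finset.univ.filter (fun x : K => x ^ k = 1 ∧ x ^ (q + 1) = 1)).erase 1).offDiag).card
      = (Nat.gcd k (q + 1) - 1) * (Nat.gcd k (q + 1) - 2) := by
  have h1 : Finset.univ.filter (fun x : K => x ^ k = 1 ∧ x ^ (q + 1) = 1)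
      = Finset.univ.filter (fun x : K => x ^ (Nat.gcd k (q + 1)) = 1) := by
    ext x
    simp [pow_gcd_eq_one]
  have hd : Nat.gcd k (q + 1) ∣ Fintype.card K - 1 := by
    refine (Nat.gcd_dvd_right _ _).trans ?_
    rw [hK]
    exact ⟨q - 1, by simpa using Nat.sq_sub_sq q 1⟩
  rw [Finset.offDiag_card, Finset.card_erase_of_mem (by simp), h1, aux_roots _ hd]
  rw [← Nat.mul_sub_one]; rfl

theorem aux_main {K : Type} [Field K] [Fintype K] [DecidableEq K] (q s : ℕ) (hq : 1 < q) (hs : 0 < s)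
    (hK : Fintype.card K = q ^ 2) (hadd : ∀ x y : K, (x + y) ^ q = x ^ q + y ^ q) :
    (Finset.univ.filter (fun x : K =>
      (x + 1) ^ (s * (q - 1) + 1) - x ^ (s * (q - 1) + 1) = 1)).card
      = q + (Nat.gcd s (q + 1) - 1) * (Nat.gcd s (q + 1) - 2)
        + (Nat.gcd (s - 1) (q + 1) - 1) * (Nat.gcd (s - 1) (q + 1) - 2) := by
  have hsub : ∀ x y : K, (x - y) ^ q = x ^ q - y ^ q := by
    intro x y
    have := hadd (x - y) y
    rw [sub_add_cancel] at this
    rw [this]; ring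
  have hpw : ∀ x : K, x ^ (s * (q - 1) + 1) = x * (x ^ (q - 1)) ^ s := by
    intro x
    rw [← pow_mul, mul_comm s, pow_succ, mul_comm]
  have hxq : ∀ x : K, x ^ (q - 1) * x = x ^ q := by
    intro x
    rw [← pow_succ]; congr 1; omega
  have hU : ∀ x : K, x ≠ 0 → (x ^ (q - 1)) ^ (q + 1) = 1 := by
    intro x hx
    rw [← pow_mul, ← FiniteField.pow_card_sub_one_eq_one x hx, hK]
    congr 1
    rw [mul_comm]; simpa using (Nat.sq_sub_sq q 1).symm
  -- characterisation of conjugates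
  have hconj : ∀ u v : K, u ^ (q + 1) = 1 → v ^ (q + 1) = 1 → u ≠ 1 → v ≠ 1 → u ≠ v →
      ((v - 1) / (u - v)) ^ (q - 1) = u ∧ ((v - 1) / (u - v) + 1) ^ (q - 1) = v := by
    intro u v hu hv hu1 hv1 huv
    have hu0 : u ≠ 0 := by rintro rfl; simp at hu
    have hv0 : v ≠ 0 := by rintro rfl; simp at hv
    have a1 : u - 1 ≠ 0 := sub_ne_zero.2 hu1
    have a2 : v - 1 ≠ 0 := sub_ne_zero.2 hv1
    have a3 : u - v ≠ 0 := sub_ne_zero.2 huv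
    have a4 : v - u ≠ 0 := sub_ne_zero.2 huv.symm
    have huq : u ^ q = u⁻¹ := by
      rw [pow_succ] at hu; exact eq_inv_of_mul_eq_one_left hu
    have hvq : v ^ q = v⁻¹ := by
      rw [pow_succ] at hv; exact eq_inv_of_mul_eq_one_left hv
    have e1 : (v - 1) / (u - v) + 1 = (u - 1) / (u - v) := by field_simp; ring
    have a5 : u⁻¹ - v⁻¹ ≠ 0 := sub_ne_zero.2 (fun h => huv (inv_injective h))
    rw [e1]
    constructor
    · apply mul_right_cancel₀ (div_ne_zero a2 a3)
      rw [hxq, div_pow, hsub, hsub, huq, hvq, one_pow, ← mul_div_assoc, div_eq_div_iff a5 a3]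
      field_simp; ring
    · apply mul_right_cancel₀ (div_ne_zero a1 a3)
      rw [hxq, div_pow, hsub, hsub, huq, hvq, one_pow, ← mul_div_assoc, div_eq_div_iff a5 a3]
      field_simp; ring
  set S := Finset.univ.filter (fun x : K =>
      (x + 1) ^ (s * (q - 1) + 1) - x ^ (s * (q - 1) + 1) = 1) with hS
  let D : ℕ → Finset (K × K) := fun k =>
    ((Finset.univ.filter (fun x : K => x ^ k = 1 ∧ x ^ (q + 1) = 1)).erase 1).offDiag
  have hD : ∀ k u v, (u, v) ∈ D k ↔ (u ≠ 1 ∧ u ^ k = 1 ∧ u ^ (q + 1) = 1) ∧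
      (v ≠ 1 ∧ v ^ k = 1 ∧ v ^ (q + 1) = 1) ∧ u ≠ v := by
    intro k u v; simp [D]
  have hss : ∀ u : K, u ^ s = u ^ (s - 1) * u := by
    intro u; rw [← pow_succ]; congr 1; omega
  have hdisj : Disjoint (D s) (D (s - 1)) := by
    rw [Finset.disjoint_left]
    rintro ⟨u, v⟩ h1 h2
    rw [hD] at h1 h2
    have := hss u
    rw [h1.1.2.1, h2.1.2.1, one_mul] at this
    exact h1.1.1 this.symm
  have hfix : ∀ x : K, x ^ q = x → x ^ (s * (q - 1) + 1) = x := by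
    intro x hx
    by_cases h0 : x = 0
    · subst h0; simp
    · have : x ^ (q - 1) = 1 := by
        apply mul_right_cancel₀ h0
        rw [hxq, hx, one_mul]
      rw [hpw, this]; simp
  have hF : (S.filter (fun x => x ^ q = x)).card = q := by
    have e : S.filter (fun x => x ^ q = x)
        = insert 0 (Finset.univ.filter (fun x : K => x ^ (q - 1) = 1)) := by
      ext x
      simp only [hS, Finset.mem_filter, Finset.mem_univ, true_and, Finset.mem_insert]
      constructor
      · rintro ⟨-, hx⟩
        by_cases h0 : x = 0
        · exact Or.inl h0
        · right
          apply mul_right_cancel₀ h0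
          rw [hxq, hx, one_mul]
      · intro h
        have hx : x ^ q = x := by
          rcases h with h | h
          · subst h; exact zero_pow (by omega)
          · rw [← hxq, h, one_mul]
        refine ⟨?_, hx⟩
        rw [hfix x hx, hfix (x + 1) (by rw [hadd, hx, one_pow])]
        ring
    rw [e, Finset.card_insert_of_notMem, aux_roots]
    · omega
    · rw [hK]
      exact ⟨q + 1, by rw [mul_comm]; simpa using Nat.sq_sub_sq q 1⟩
    · simp only [Finset.mem_filter, Finset.mem_univ, true_and]
      rw [zero_pow (by omega)]; exact zero_ne_one
  have hG : (S.filter (fun x => ¬ x ^ q = x)).card = (D s ∪ D (s - 1)).card := by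
    have hx1 : ∀ x : K, ¬ x ^ q = x → x ≠ 0 ∧ x + 1 ≠ 0 ∧ x ^ (q - 1) ≠ 1 ∧
        (x + 1) ^ (q - 1) ≠ 1 ∧ x * (x ^ (q - 1) - (x + 1) ^ (q - 1)) = (x + 1) ^ (q - 1) - 1 := by
      intro x hx
      have k2 := hxq (x + 1)
      rw [hadd, one_pow, ← hxq x] at k2
      have k3 : (x + 1) ^ (q - 1) ≠ 1 := by
        intro h
        rw [h] at k2
        exact hx (by rw [← hxq]; linear_combination -k2)
      have k0 : x ≠ 0 := by rintro rfl; exact hx (zero_pow (by omega))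
      have k1 : x ^ (q - 1) ≠ 1 := by
        intro h; exact hx (by rw [← hxq, h, one_mul])
      refine ⟨k0, ?_, k1, k3, by linear_combination -k2⟩
      intro h
      rw [h] at k2
      apply k1
      apply mul_right_cancel₀ k0
      linear_combination -k2 - h
    have hx2 : ∀ x : K, ¬ x ^ q = x → x ^ (q - 1) ≠ (x + 1) ^ (q - 1) := by
      intro x hx h
      obtain ⟨-, -, -, k3, k4⟩ := hx1 x hx
      rw [h, sub_self, mul_zero] at k4
      exact k3 (by linear_combination -k4)
    refine Finset.card_nbij' (fun x => (x ^ (q - 1), (x + 1) ^ (q - 1)))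
      (fun w => (w.2 - 1) / (w.1 - w.2)) ?_ ?_ ?_ ?_
    · intro x hx
      have hx := Finset.mem_coe.1 hx
      apply Finset.mem_coe.2
      simp only [hS, Finset.mem_filter, Finset.mem_univ, true_and] at hx
      obtain ⟨he, hx⟩ := hx
      obtain ⟨k0, k1, k2, k3, k4⟩ := hx1 x hx
      have k5 := hx2 x hx
      have u1 := hU x k0
      have v1 := hU (x + 1) k1
      have cu := hxq x
      have cv := hxq (x + 1)
      rw [hpw, hpw] at he
      simp only [Finset.mem_union, hD]
      generalize x ^ (q - 1) = u at *
      generalize (x + 1) ^ (q - 1) = v at *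
      have k6 : u - v ≠ 0 := sub_ne_zero.2 k5
      have hA : (u ^ s) ^ q * u ^ s = 1 := by
        rw [← pow_succ, ← pow_mul, mul_comm, pow_mul, u1, one_pow]
      have hB : (v ^ s) ^ q * v ^ s = 1 := by
        rw [← pow_succ, ← pow_mul, mul_comm, pow_mul, v1, one_pow]
      have he2 : ((x + 1) * v ^ s - x * u ^ s) ^ q = 1 := by rw [he, one_pow]
      rw [hsub, mul_pow, mul_pow, ← cu, ← cv] at he2
      have u0 : u ≠ 0 := by rintro rfl; simp at u1
      have v0 : v ≠ 0 := by rintro rfl; simp at v1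
      have hsu := hss u
      have hsv := hss v
      have := aux_core_s3 u v (u ^ s) (v ^ s) k2 k3 k5
        (by linear_combination (u - v) * he + (u ^ s - v ^ s) * k4)
        (by
          generalize u ^ s = A at *
          generalize v ^ s = B at *
          generalize A ^ q = A' at *
          generalize B ^ q = B' at *
          have : (x + 1) * v * A - x * u * B = A * B := by
            linear_combination A * B * he2 - (x + 1) * v * A * hB + x * u * B * hA
          linear_combination (u - v) * this + (u * B - v * A) * k4)
      rcases this with ⟨h1, h2⟩ | ⟨h1, h2⟩
      · left; exact ⟨⟨k2, h1, u1⟩, ⟨k3, h2, v1⟩, k5⟩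
      · right
        refine ⟨⟨k2, ?_, u1⟩, ⟨k3, ?_, v1⟩, k5⟩
        · apply mul_right_cancel₀ u0
          rw [← hsu, h1, one_mul]
        · apply mul_right_cancel₀ v0
          rw [← hsv, h2, one_mul]
    · rintro ⟨u, v⟩ hw
      have hw := Finset.mem_coe.1 hw
      apply Finset.mem_coe.2
      have hh : u ≠ 1 ∧ v ≠ 1 ∧ u ≠ v ∧ u ^ (q + 1) = 1 ∧ v ^ (q + 1) = 1 ∧
          ((u ^ s = 1 ∧ v ^ s = 1) ∨ (u ^ s = u ∧ v ^ s = v)) := by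
        rw [Finset.mem_union, hD, hD] at hw
        rcases hw with ⟨⟨a, b, c⟩, ⟨a', b', c'⟩, e⟩ | ⟨⟨a, b, c⟩, ⟨a', b', c'⟩, e⟩
        · exact ⟨a, a', e, c, c', Or.inl ⟨b, b'⟩⟩
        · exact ⟨a, a', e, c, c', Or.inr ⟨by rw [hss, b, one_mul], by rw [hss, b', one_mul]⟩⟩
      obtain ⟨a, a', e, c, c', h⟩ := hh
      obtain ⟨r1, r2⟩ := hconj u v c c' a a' e
      have a2 : v - 1 ≠ 0 := sub_ne_zero.2 a'
      have a3 : u - v ≠ 0 := sub_ne_zero.2 e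
      simp only [hS, Finset.mem_filter, Finset.mem_univ, true_and]
      constructor
      · rw [hpw, hpw, r1, r2]
        rcases h with ⟨h1, h2⟩ | ⟨h1, h2⟩
        · rw [h1, h2]; ring
        · rw [h1, h2]; field_simp; ring
      · intro hx
        rw [← hxq, r1] at hx
        apply a
        apply mul_right_cancel₀ (div_ne_zero a2 a3)
        rw [hx, one_mul]
    · intro x hx
      have hx := Finset.mem_coe.1 hx
      have hx := (Finset.mem_filter.1 hx).2
      obtain ⟨k0, k1, k2, k3, k4⟩ := hx1 x hx
      exact (div_eq_iff (sub_ne_zero.2 (hx2 x hx))).2 k4.symm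
    · rintro ⟨u, v⟩ hw
      have hw := Finset.mem_coe.1 hw
      rw [Finset.mem_union, hD, hD] at hw
      have := hconj u v (by tauto) (by tauto) (by tauto) (by tauto) (by tauto)
      exact Prod.ext this.1 this.2
  rw [← Finset.card_filter_add_card_filter_not (s := S) (fun x => x ^ q = x), hF, hG,
    Finset.card_union_of_disjoint hdisj, aux_T q s hq hK, aux_T q (s-1) hq hK]
  ring

/-- `Δ_F(1,1) = p^m + (s₁-1)(s₁-2) + (s₂-1)(s₂-2)` for the Niho
power function `F(x) = x^(s(p^m-1)+1)` over `K = GF(p^(2m))`, where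
`s₁ = gcd(s, p^m+1)` and `s₂ = gcd(s-1, p^m+1)`. -/
theorem stmt_3 (p m s : ℕ) (hp : p.Prime) (hm : 0 < m) (hs : 0 < s)
    (K : Type) [Field K] [Fintype K] (hK : Fintype.card K = p ^ (2 * m))
    (d : ℕ) (hd : d = s * (p ^ m - 1) + 1) :
    Nat.card {x : K // (x + 1) ^ d - x ^ d = 1}
      = p ^ m
        + (Nat.gcd s (p ^ m + 1) - 1) * (Nat.gcd s (p ^ m + 1) - 2)
        + (Nat.gcd (s - 1) (p ^ m + 1) - 1) * (Nat.gcd (s - 1) (p ^ m + 1) - 2) := by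
  classical
  haveI : Fact p.Prime := ⟨hp⟩
  haveI : CharP K p := charP_of_card_eq_prime_pow hK
  subst hd
  rw [Nat.card_eq_fintype_card, Fintype.card_subtype]
  exact aux_main (p ^ m) s (Nat.one_lt_pow hm.ne' hp.one_lt) hs
    (by rw [hK, ← pow_mul, mul_comm]) (fun x y => add_pow_char_pow x y ..)
end

section
/- If b ∈ K satisfies b^{p^m + 1} ≠ 1, then the equation (x+1)^d − x^d = b has at most p^m solutions x in K, i.e., Δ_F(1,b) ≤ p^m. -/
/-- if `b ∈ K = GF(p^(2m))` satisfies `b^(p^m+1) ≠ 1`, then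
`Δ_F(1,b) ≤ p^m` for the Niho power function `F(x) = x^(s(p^m-1)+1)`. -/
theorem stmt_4 (p m s : ℕ) (hp : p.Prime) (hm : 0 < m) (hs : 0 < s)
    (K : Type) [Field K] [Fintype K] (hK : Fintype.card K = p ^ (2 * m))
    (d : ℕ) (hd : d = s * (p ^ m - 1) + 1)
    (b : K) (hb : b ^ (p ^ m + 1) ≠ 1) :
    Nat.card {x : K // (x + 1) ^ d - x ^ d = b} ≤ p ^ m := by
  classical
  haveI : Fact p.Prime := ⟨hp⟩
  haveI : CharP K p := charP_of_card_eq_prime_pow hK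
  have hadd : ∀ x y : K, (x + y) ^ (p ^ m) = x ^ (p ^ m) + y ^ (p ^ m) :=
    fun x y => add_pow_char_pow x y p m
  have hsub : ∀ x y : K, (x - y) ^ (p ^ m) = x ^ (p ^ m) - y ^ (p ^ m) :=
    fun x y => sub_pow_char_pow x y m
  have hq1 : 1 ≤ p ^ m := Nat.one_le_pow _ _ hp.pos
  have hcard : Fintype.card K = p ^ m * p ^ m := by rw [hK, two_mul, pow_add]
  generalize hq : p ^ m = q at *
  have hunit : ∀ x : K, x ≠ 0 → (x ^ (q - 1)) ^ (q + 1) = 1 := by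
    intro x hx
    rw [← pow_mul]
    have : (q - 1) * (q + 1) = Fintype.card K - 1 := by
      rw [hcard]; obtain ⟨k, rfl⟩ := Nat.exists_eq_add_of_le hq1
      simp; ring_nf; omega
    rw [this]; exact FiniteField.pow_card_sub_one_eq_one x hx
  have hxq : ∀ x : K, x ^ q = x ^ (q - 1) * x := by
    intro x; rw [← pow_succ, Nat.sub_add_cancel hq1]
  have hxd : ∀ x : K, x ^ d = (x ^ (q - 1)) ^ s * x := by
    intro x; rw [hd, pow_succ, mul_comm s, pow_mul]
  have hneg : ((-1 : K)) ^ q = -1 := by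
    have h := hsub 0 1
    simpa [show q ≠ 0 by omega] using h
  -- solutions nonzero
  have h0 : ∀ x : K, (x + 1) ^ d - x ^ d = b → x ≠ 0 := by
    rintro x hx rfl
    apply hb; rw [← hx, hd]; simp
  have h1 : ∀ x : K, (x + 1) ^ d - x ^ d = b → x + 1 ≠ 0 := by
    intro x hx hx1
    have : x = -1 := eq_neg_of_add_eq_zero_left hx1
    subst this
    apply hb
    have h2 := hunit (-1 : K) (by simp)
    rw [← hx, hxd, hxd]
    simp only [neg_add_cancel, mul_zero, zero_sub, mul_neg, mul_one, neg_neg]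
    rw [← pow_mul, mul_comm, pow_mul, h2, one_pow]
  -- key facts
  have key : ∀ x : K, (x + 1) ^ d - x ^ d = b → ∃ c : K,
      x * (c - (x ^ (q - 1)) ^ s) = b - c ∧ c ≠ (x ^ (q - 1)) ^ s ∧
      (x ≠ 0) ∧ c ^ (q + 1) = 1 ∧ (x ^ (q-1) = 1 → c = 1) := by
    intro x hx
    have hc : (((x + 1) ^ (q - 1)) ^ s) ^ (q + 1) = 1 := by
      rw [← pow_mul, mul_comm, pow_mul, hunit _ (h1 x hx), one_pow]
    refine ⟨((x + 1) ^ (q - 1)) ^ s, ?_, ?_, h0 x hx, hc, ?_⟩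
    · rw [hxd, hxd] at hx
      rw [← hx]; ring
    · intro h
      apply hb
      rw [hxd, hxd, ← h] at hx
      have : b = ((x + 1) ^ (q - 1)) ^ s := by rw [← hx]; ring
      rw [this, hc]
    · intro hu
      have h3 : (x + 1) ^ (q - 1) * (x + 1) = 1 * (x + 1) := by
        rw [← hxq, hadd, hxq x, hu]; simp
      rw [mul_right_cancel₀ (h1 x hx) h3, one_pow]
  -- conjugate relation
  have conj : ∀ x c a : K, x ≠ 0 → a ^ (q + 1) = 1 → c ^ (q + 1) = 1 → c ≠ a →
      x * (c - a) = b - c → x ^ (q - 1) * (b - c) = a * (1 - b ^ q * c) := by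
    intro x c a hx ha hc hca h
    have h2 := congrArg (· ^ q) h
    simp only [mul_pow, hsub] at h2
    rw [hxq] at h2
    rw [pow_succ] at ha hc
    generalize x ^ (q - 1) = u at *
    generalize a ^ q = a' at *
    generalize c ^ q = c' at *
    generalize b ^ q = b' at *
    rw [← h]
    linear_combination (-a * c) * h2 + (u * x * a + a) * hc - u * x * c * ha
  have haU : ∀ x : K, x ≠ 0 → ((x ^ (q - 1)) ^ s) ^ (q + 1) = 1 := by
    intro x hx
    rw [← pow_mul, mul_comm, pow_mul, hunit _ hx, one_pow]
  rw [Nat.card_eq_fintype_card, Fintype.card_subtype]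
  have hT : ((Polynomial.nthRootsFinset (q + 1) (1 : K)).erase 1).card ≤ q := by
    rw [Finset.card_erase_of_mem ((Polynomial.mem_nthRootsFinset (by omega) _).2 (one_pow _))]
    have := Polynomial.card_nthRoots (q + 1) (1 : K)
    have h2 : (Polynomial.nthRootsFinset (q + 1) (1 : K)).card ≤ q + 1 := by
      rw [Polynomial.nthRootsFinset_def]
      exact (Multiset.toFinset_card_le _).trans this
    omega
  refine le_trans (Finset.card_le_card_of_injOn (fun x => x ^ (q - 1)) ?_ ?_) hT
  · intro x hx
    simp only [Finset.coe_filter, Finset.mem_univ, true_and, Set.mem_setOf_eq] at hx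
    obtain ⟨c, -, h2, h3, -, h5⟩ := key x hx
    simp only [Finset.coe_erase, Set.mem_diff, Finset.mem_coe, Set.mem_singleton_iff]
    refine ⟨(Polynomial.mem_nthRootsFinset (by omega) _).2 (hunit x h3), fun hu => h2 ?_⟩
    rw [h5 hu, hu, one_pow]
  · intro x hx y hy hxy
    simp only [Finset.coe_filter, Finset.mem_univ, true_and, Set.mem_setOf_eq] at hx hy
    obtain ⟨c, e1, e2, e3, e4, -⟩ := key x hx
    obtain ⟨c', f1, f2, f3, f4, -⟩ := key y hy
    have E := conj x c _ e3 (haU x e3) e4 e2 e1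
    have F := conj y c' _ f3 (haU y f3) f4 f2 f1
    have hu0 : x ^ (q - 1) ≠ 0 := pow_ne_zero _ e3
    simp only at hxy
    rw [← hxy] at F f1 f2
    generalize x ^ (q - 1) = u at *
    generalize u ^ s = a at *
    rw [pow_succ] at hb
    have hcc : c = c' := by
      by_contra hne
      have hne' : c - c' ≠ 0 := sub_ne_zero.2 hne
      have g1 : a * b ^ q = u := by
        apply mul_right_cancel₀ hne'
        linear_combination E - F
      have g2 : u * b = a := by linear_combination E - c * g1
      apply hb
      apply mul_left_cancel₀ hu0
      linear_combination b ^ q * g2 + g1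
    subst hcc
    apply mul_right_cancel₀ (sub_ne_zero.2 e2)
    rw [e1, f1]
end

section
/- If b ∈ K satisfies b^{p^m + 1} = 1 and b ≠ 1, then the equation (x+1)^d − x^d = b has at most s₁(s₁ − 1) + s₂(s₂ − 1) solutions x in K, i.e., Δ_F(1,b) ≤ s₁(s₁ − 1) + s₂(s₂ − 1). -/
theorem aux_count {K : Type} [Field K] [Fintype K] [DecidableEq K] (N k : ℕ) (hN : 0 < N) (b : K) :
    (Finset.univ.filter (fun y : K => y ^ N = 1 ∧ y ^ k = b)).card ≤ Nat.gcd k N := by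
  set g := Nat.gcd k N with hg
  have hgpos : 0 < g := Nat.gcd_pos_of_pos_right _ hN
  rcases Finset.eq_empty_or_nonempty
    (Finset.univ.filter (fun y : K => y ^ N = 1 ∧ y ^ k = b)) with h | ⟨y0, h0⟩
  · rw [h]; simp
  · simp only [Finset.mem_filter, Finset.mem_univ, true_and] at h0
    have hne : ∀ y : K, y ^ N = 1 → y ≠ 0 := by
      rintro y hy rfl
      rw [zero_pow hN.ne'] at hy
      exact zero_ne_one hy
    have hy0 := hne y0 h0.1
    refine le_trans (Finset.card_le_card (t := (Polynomial.nthRoots g (y0 ^ g)).toFinset) ?_) ?_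
    · intro y hy
      simp only [Finset.mem_filter, Finset.mem_univ, true_and] at hy
      rw [Multiset.mem_toFinset, Polynomial.mem_nthRoots hgpos]
      have hyne := hne y hy.1
      have h1 : (y / y0) ^ N = 1 := by rw [div_pow, hy.1, h0.1, div_one]
      have h2 : (y / y0) ^ k = 1 := by
        rw [div_pow, hy.2, h0.2]
        exact div_self (by rw [← h0.2]; exact pow_ne_zero _ hy0)
      have h3 : (y / y0) ^ g = 1 := by
        rw [← orderOf_dvd_iff_pow_eq_one]
        exact Nat.dvd_gcd (orderOf_dvd_of_pow_eq_one h2) (orderOf_dvd_of_pow_eq_one h1)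
      rw [div_pow, div_eq_one_iff_eq (pow_ne_zero _ hy0)] at h3
      exact h3
    · exact (Multiset.toFinset_card_le _).trans (Polynomial.card_nthRoots _ _)

theorem aux_core_s5 {K : Type} [Field K] (x y z Y Z Y' Z' b b' : K) (hx : x ≠ 0) (hx1 : x + 1 ≠ 0)
    (hz : (x + 1) * z = x * y + 1) (hY : Y * Y' = 1) (hZ : Z * Z' = 1) (hb : b * b' = 1)
    (h1 : (x + 1) * Z - x * Y = b) (h2 : (x + 1) * z * Z' - x * y * Y' = b') :
    Z = Y ∨ Z * y = Y * z := by
  have key : x * (x + 1) * ((Z - Y) * (Z * y - Y * z)) = 0 := by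
    subst h1 h2
    have e : x * (x + 1) * (y + z) = x * (x + 1) * (Z * Y' * y + Y * Z' * z) := by
      linear_combination hb - (x + 1) * (x + 1) * z * hZ - x * x * y * hY - hz
    linear_combination (-Y * Z) * e - x * (x + 1) * Z * Z * y * hY - x * (x + 1) * Y * Y * z * hZ
  rcases mul_eq_zero.1 key with h | h
  · exact absurd h (mul_ne_zero hx hx1)
  · rcases mul_eq_zero.1 h with h | h
    · exact Or.inl (sub_eq_zero.1 h)
    · exact Or.inr (sub_eq_zero.1 h)

theorem aux_mono (a g : ℕ) (h : a ≤ g) : a * a - a ≤ g * (g - 1) := by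
  have : a * a - a = a * (a - 1) := by rw [Nat.mul_sub, mul_one]
  rw [this]
  exact Nat.mul_le_mul h (Nat.sub_le_sub_right h 1)

/-- if `b ∈ K = GF(p^(2m))` satisfies `b^(p^m+1) = 1` and `b ≠ 1`,
then `Δ_F(1,b) ≤ s₁(s₁-1) + s₂(s₂-1)` for the Niho power function
`F(x) = x^(s(p^m-1)+1)`, where `s₁ = gcd(s, p^m+1)` and `s₂ = gcd(s-1, p^m+1)`. -/
theorem stmt_5 (p m s : ℕ) (hp : p.Prime) (hm : 0 < m) (hs : 0 < s)
    (K : Type) [Field K] [Fintype K] (hK : Fintype.card K = p ^ (2 * m))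
    (d : ℕ) (hd : d = s * (p ^ m - 1) + 1)
    (b : K) (hb1 : b ^ (p ^ m + 1) = 1) (hb2 : b ≠ 1) :
    Nat.card {x : K // (x + 1) ^ d - x ^ d = b}
      ≤ Nat.gcd s (p ^ m + 1) * (Nat.gcd s (p ^ m + 1) - 1)
        + Nat.gcd (s - 1) (p ^ m + 1) * (Nat.gcd (s - 1) (p ^ m + 1) - 1) := by
  classical
  have : Fact p.Prime := ⟨hp⟩
  have : CharP K p := charP_of_card_eq_prime_pow hK
  have hfrob : ∀ u v : K, (u - v) ^ p ^ m = u ^ p ^ m - v ^ p ^ m := fun u v => by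
    exact sub_pow_char_pow u v m
  have hfroba : ∀ u v : K, (u + v) ^ p ^ m = u ^ p ^ m + v ^ p ^ m := fun u v => by
    exact add_pow_char_pow u v p m
  have hcard : Fintype.card K = p ^ m * p ^ m := by rw [hK, two_mul, pow_add]
  have hq1 : 1 ≤ p ^ m := Nat.one_le_pow _ _ hp.pos
  generalize p ^ m = q at *
  obtain ⟨r, rfl⟩ : ∃ r, q = r + 1 := ⟨q - 1, by omega⟩
  obtain ⟨t, rfl⟩ : ∃ t, s = t + 1 := ⟨s - 1, by omega⟩
  simp only [Nat.add_sub_cancel] at *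
  have hunit : ∀ u : K, u ≠ 0 → (u ^ r) ^ (r + 1 + 1) = 1 := by
    intro u hu
    rw [← pow_mul, ← FiniteField.pow_card_sub_one_eq_one u hu, hcard]
    congr 1
    have : (r + 1) * (r + 1) = r * (r + 1 + 1) + 1 := by ring
    omega
  have hpd : ∀ u : K, u ^ d = u * (u ^ r) ^ (t + 1) := by
    intro u
    rw [hd, pow_succ, ← pow_mul]; ring
  have hne : ∀ x : K, (x + 1) ^ d - x ^ d = b → x ≠ 0 ∧ x + 1 ≠ 0 := by
    intro x hx
    constructor
    · rintro rfl
      apply hb2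
      rw [← hx, hd]; simp
    · intro h0
      apply hb2
      have hx1 : x = -1 := by linear_combination h0
      have e : (-1 : K) ^ (r + 1) = -1 := by
        have := hfrob 0 1
        simpa using this
      have e2 : (-1 : K) ^ r = 1 := by
        rw [pow_succ] at e
        simpa using e
      rw [← hx, hpd, hpd, h0, hx1, e2]; simp
  have hz : ∀ x : K, (x + 1) * (x + 1) ^ r = x * x ^ r + 1 := by
    intro x
    have := hfroba x 1
    rw [one_pow, pow_succ', pow_succ'] at this
    exact this
  have hmain : ∀ x : K, (x + 1) ^ d - x ^ d = b → x ^ r ≠ (x + 1) ^ r ∧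
      ((x ^ r) ^ (t + 1) = b ∧ ((x + 1) ^ r) ^ (t + 1) = b ∨
       (x ^ r) ^ t = b ∧ ((x + 1) ^ r) ^ t = b) := by
    intro x hx
    obtain ⟨h0, h1⟩ := hne x hx
    have hy1 := hunit x h0
    have hz1 := hunit _ h1
    have hzx := hz x
    have hyq : x ^ (r + 1) = x * x ^ r := pow_succ' _ _
    have hzq : (x + 1) ^ (r + 1) = (x + 1) * (x + 1) ^ r := pow_succ' _ _
    have hyne : x ^ r ≠ 0 := pow_ne_zero _ h0
    have hzne : (x + 1) ^ r ≠ 0 := pow_ne_zero _ h1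
    rw [hpd, hpd] at hx
    generalize x ^ r = y at *
    generalize (x + 1) ^ r = z at *
    have hcases : z ^ (t + 1) = y ^ (t + 1) ∨ z ^ (t + 1) * y = y ^ (t + 1) * z := by
      refine aux_core_s5 x y z (y ^ (t + 1)) (z ^ (t + 1)) ((y ^ (t + 1)) ^ (r + 1))
        ((z ^ (t + 1)) ^ (r + 1)) b (b ^ (r + 1)) h0 h1 hzx ?_ ?_ ?_ hx ?_
      · rw [← pow_succ', ← pow_mul, mul_comm, pow_mul, hy1, one_pow]
      · rw [← pow_succ', ← pow_mul, mul_comm, pow_mul, hz1, one_pow]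
      · rw [← pow_succ', hb1]
      · rw [← hx, hfrob, mul_pow, mul_pow, hyq, hzq]
    have hB : (y ^ (t + 1) = b ∧ z ^ (t + 1) = b) ∨ (y ^ t = b ∧ z ^ t = b) := by
      rcases hcases with h | h
      · left
        rw [h] at hx ⊢
        have : y ^ (t + 1) = b := by linear_combination hx
        exact ⟨this, this⟩
      · right
        have e : z ^ t = y ^ t := by
          apply mul_right_cancel₀ (mul_ne_zero hyne hzne)
          rw [pow_succ, pow_succ] at h
          linear_combination h
        rw [pow_succ, pow_succ, e] at hx
        have : y ^ t = b := by linear_combination hx - y ^ t * hzx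
        exact ⟨this, e.trans this⟩
    refine ⟨?_, hB⟩
    rintro rfl
    have hy : y = 1 := by linear_combination hzx
    subst hy
    apply hb2
    rcases hB with h | h
    · rw [← h.1, one_pow]
    · rw [← h.1, one_pow]
  set S : ℕ → Finset K := fun k => Finset.univ.filter (fun y : K => y ^ (r + 1 + 1) = 1 ∧ y ^ k = b)
    with hS
  have hle : Nat.card {x : K // (x + 1) ^ d - x ^ d = b}
      ≤ ((S (t + 1)).offDiag ∪ (S t).offDiag).card := by
    rw [Nat.card_eq_fintype_card, Fintype.card_subtype]
    apply Finset.card_le_card_of_injOn (fun x => (x ^ r, (x + 1) ^ r))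
    · intro x hx
      have hx' : (x + 1) ^ d - x ^ d = b := by simpa using hx
      obtain ⟨h0, h1⟩ := hne x hx'
      have hy1 := hunit x h0
      have hz1 := hunit _ h1
      obtain ⟨hd1, hd2⟩ := hmain x hx'
      simp only [hS, Finset.coe_union, Set.mem_union, Finset.mem_coe, Finset.mem_offDiag,
        Finset.mem_filter, Finset.mem_univ, true_and]
      tauto
    · intro x hx x' hx' hxx
      have hx1 : (x + 1) ^ d - x ^ d = b := by simpa using hx
      have hne1 := (hmain x hx1).1
      simp only [Prod.mk.injEq] at hxx
      have e1 := hz x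
      have e2 := hz x'
      rw [← hxx.1, ← hxx.2] at e2
      have : (x - x') * ((x + 1) ^ r - x ^ r) = 0 := by linear_combination e1 - e2
      rcases mul_eq_zero.1 this with h | h
      · exact sub_eq_zero.1 h
      · exact absurd (sub_eq_zero.1 h).symm hne1
  refine hle.trans ((Finset.card_union_le _ _).trans ?_)
  rw [Finset.offDiag_card, Finset.offDiag_card]
  exact Nat.add_le_add (aux_mono _ _ (aux_count _ _ (by omega) b))
    (aux_mono _ _ (aux_count _ _ (by omega) b))
end

section
/- Assume p = 2 and that F is locally-APN. Then for all a, b ∈ K: FBCT_F(a,b) = 2^n if a·b·(a+b) = 0; FBCT_F(a,b) = 2^m if a·b·(a+b) ≠ 0 and a/b ∈ F_{2^m}; and FBCT_F(a,b) = 0 if a·b·(a+b) ≠ 0 and a/b ∉ F_{2^m}. Moreover, the case a·b·(a+b) = 0 occurs for exactly 3·2^n − 2 pairs (a,b), the value 2^m occurs for exactly (2^m − 2)(2^n − 1) pairs, and the value 0 occurs for exactly (2^n − 2^m)(2^n − 1) pairs. -/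
theorem aux_one {K : Type} [Field K] [CharP K 2] (f : K →+* K) (ff : ∀ x, f (f x) = x)
    (F : K → K) (Fmul : ∀ x y, F (x * y) = F x * F y)
    (Fn : ∀ x, F x * f (F x) = x * f x) (Fr : ∀ r, f r = r → F r = r)
    (H : ∀ x y z : K, x ≠ y → y ≠ z → x ≠ z → F (y + 1) + F y = F (x + 1) + F x →
      F (z + 1) + F z = F (x + 1) + F x → F (x + 1) + F x = 0 ∨ F (x + 1) + F x = 1)
    (H2 : ∃ x, F (x + 1) + F x ≠ 1) (x : K) (hx : F (x + 1) + F x = 1) : f x = x := by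
  have h2 : (2 : K) = 0 := CharTwo.two_eq_zero
  by_contra hxf
  have key : ∃ g : K →+* K, F x = g x ∧ ∀ r, f r = r → g r = r := by
    have e : F (x + 1) = F x + 1 := by grind
    have n1 := Fn x
    have n2 := Fn (x + 1)
    rw [e] at n2
    simp only [map_add, map_one] at n2
    have : (F x - x) * (F x - f x) = 0 := by grind
    rcases mul_eq_zero.1 this with h | h
    · exact ⟨RingHom.id K, sub_eq_zero.1 h, fun r _ => rfl⟩
    · exact ⟨f, sub_eq_zero.1 h, fun r h => h⟩
  obtain ⟨g, gx, gr⟩ := key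
  have gx1 : F (x + 1) = g (x + 1) := by
    rw [map_add, map_one, ← gx]; grind
  have all : ∀ z, F z = g z := by
    intro z
    by_contra hz
    have ht0 : x + f x ≠ 0 := by grind
    obtain ⟨t, ht⟩ : ∃ t, t = (z + f z) / (x + f x) := ⟨_, rfl⟩
    have ft : f t = t := by
      rw [ht, map_div₀, map_add, map_add, ff, ff, add_comm, add_comm (f x)]
    have ht' : t * (x + f x) = z + f z := by rw [ht]; field_simp
    obtain ⟨r, hr⟩ : ∃ r, r = z + t * x := ⟨_, rfl⟩
    have fr : f r = r := by
      rw [hr, map_add, map_mul, ft]; grind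
    have zr : z = r + t * x := by grind
    have frt : f (r + t) = r + t := by rw [map_add, fr, ft]
    have F1 : F (t * x) = g (t * x) := by rw [Fmul, map_mul, Fr t ft, gr t ft, gx]
    have F2 : F (t * (x + 1)) = g (t * (x + 1)) := by
      rw [Fmul, map_mul, Fr t ft, gr t ft, gx1]
    have F3 : F r = g r := by rw [Fr r fr, gr r fr]
    have F4 : F (r + t) = g (r + t) := by rw [Fr _ frt, gr _ frt]
    have z0 : z ≠ 0 := by
      rintro rfl; apply hz; rw [Fr 0 (map_zero f), map_zero]
    have t0 : t ≠ 0 := by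
      rintro rfl; apply hz; rw [zr]; simpa using F3
    have F1' : F 1 = 1 := Fr 1 (map_one f)
    have Fz0 : F z ≠ 0 := by
      intro h
      have := Fmul z z⁻¹
      rw [mul_inv_cancel₀ z0, h, F1'] at this
      simp at this
    have D : ∀ w v, w + v = z → F w = g w → F v = g v →
        F (w / z + 1) + F (w / z) = g z / F z := by
      intro w v hwv hw hv
      have e1 : w / z + 1 = v * z⁻¹ := by field_simp; grind
      have e2 : F z * F z⁻¹ = 1 := by rw [← Fmul, mul_inv_cancel₀ z0, F1']
      have e3 : F z⁻¹ = (F z)⁻¹ := (inv_eq_of_mul_eq_one_right e2).symm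
      rw [e1, div_eq_mul_inv w z, Fmul, Fmul, e3, ← hwv, map_add, hw, hv, hwv]
      field_simp
      ring
    have D1 := D r (t * x) zr.symm F3 F1
    have D2 := D (t * x) r (by grind) F1 F3
    have D3 := D (r + t) (t * (x + 1)) (by grind) F4 F2
    have nx : ∀ w, f w = w → t * x ≠ w := by
      intro w hw h
      apply hxf
      have : f (t * x) = t * x := by rw [h, hw]
      rw [map_mul, ft] at this
      exact mul_left_cancel₀ t0 this
    have dv : ∀ p q : K, p ≠ q → p / z ≠ q / z := by
      intro p q h h'
      exact h ((div_left_inj' z0).1 h')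
    have := H (r / z) (t * x / z) ((r + t) / z) (dv _ _ (nx r fr).symm) (dv _ _ (nx _ frt))
      (dv _ _ (by simpa using t0)) (by rw [D1, D2]) (by rw [D1, D3])
    rw [D1] at this
    rcases this with h | h
    · rcases div_eq_zero_iff.1 h with h | h
      · exact z0 ((map_eq_zero g).1 h)
      · exact Fz0 h
    · exact hz ((div_eq_one_iff_eq Fz0).1 h).symm
  obtain ⟨y, hy⟩ := H2
  apply hy
  rw [all, all, map_add, map_one]
  grind

theorem aux_main_s14 {K : Type} [Field K] [CharP K 2] (f : K →+* K) (ff : ∀ x, f (f x) = x)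
    (F : K → K) (Fmul : ∀ x y, F (x * y) = F x * F y) (Ff : ∀ x, F (f x) = f (F x))
    (Fn : ∀ x, F x * f (F x) = x * f x) (Fr : ∀ r, f r = r → F r = r)
    (H : ∀ x y z : K, x ≠ y → y ≠ z → x ≠ z → F (y + 1) + F y = F (x + 1) + F x →
      F (z + 1) + F z = F (x + 1) + F x → F (x + 1) + F x = 0 ∨ F (x + 1) + F x = 1)
    (H2 : ∃ x, F (x + 1) + F x ≠ 1) (a x : K) (a0 : a ≠ 0) (a1 : a ≠ 1) :
    F (x + a + 1) + F (x + a) = F (x + 1) + F x ↔ f x = x ∧ f a = a := by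
  have h2 : (2 : K) = 0 := CharTwo.two_eq_zero
  have L := aux_one f ff F Fmul Fn Fr H H2
  have L0 : ∀ x, F (x + 1) + F x = 0 → f x = x + 1 := by
    intro x hx
    have e : F (x + 1) = F x := by grind
    have n1 := Fn x
    have n2 := Fn (x + 1)
    rw [e] at n2
    simp only [map_add, map_one] at n2
    grind
  constructor
  · intro h
    have h' : F (x + 1 + 1) + F (x + 1) = F (x + 1) + F x := by
      have : x + 1 + 1 = x := by grind
      rw [this, add_comm]
    rcases H x (x + 1) (x + a) (by simp) (by simpa using a1.symm) (by simpa using a0) h' h with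
      hc | hc
    · exfalso
      rw [hc] at h
      have f1 := L0 x hc
      have f2 := L0 _ h
      have fa : f a = a := by rw [map_add] at f2; grind
      have R : ∀ y, F (y + 1) + F y = 0 → f (F y) = F y := by
        intro y hy
        rw [← Ff, L0 y hy]; grind
      have Rx := R x hc
      have Ry := R _ h
      have fia : f a⁻¹ = a⁻¹ := by rw [map_inv₀, fa]
      have Fia : F a⁻¹ = a⁻¹ := Fr _ fia
      have e1 : x * a⁻¹ + 1 = (x + a) * a⁻¹ := by field_simp
      have fD : f (F (x * a⁻¹ + 1) + F (x * a⁻¹)) = F (x * a⁻¹ + 1) + F (x * a⁻¹) := by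
        rw [e1, Fmul, Fmul, Fia, map_add, map_mul, map_mul, Rx, Ry, fia]
      have fX : f (x * a⁻¹) = x * a⁻¹ + a⁻¹ := by rw [map_mul, f1, fia]; ring
      have ia0 : a⁻¹ ≠ 0 := inv_ne_zero a0
      have ia1 : a⁻¹ ≠ 1 := by simpa using a1
      rcases H (x * a⁻¹) (x * a⁻¹ + 1) (f (x * a⁻¹)) (by simp)
        (by rw [fX]; simpa using ia1.symm) (by rw [fX]; simpa using ia0)
        (by
          have : x * a⁻¹ + 1 + 1 = x * a⁻¹ := by grind
          rw [this, add_comm])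
        (by
          rw [← fD, map_add f (F _), ← Ff, ← Ff, map_add, map_one]) with hc | hc
      · have := L0 _ hc
        rw [fX] at this
        exact ia1 (add_left_cancel this)
      · have := L _ hc
        rw [fX] at this
        exact ia0 (by simpa using this)
    · have fx := L x hc
      rw [hc] at h
      have := L _ h
      rw [map_add, fx] at this
      exact ⟨fx, add_left_cancel this⟩
  · rintro ⟨fx, fa⟩
    have : ∀ y, f y = y → F (y + 1) + F y = 1 := by
      intro y hy
      rw [Fr y hy, Fr (y + 1) (by rw [map_add, hy, map_one])]
      grind
    rw [this x fx, this (x + a) (by rw [map_add, fx, fa])]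

theorem card_fix {K : Type} [Field K] [Fintype K] [CharP K 2] (m : ℕ) (hm : 0 < m)
    (hK : Fintype.card K = 2 ^ (2 * m)) (f : K →+* K) (ff : ∀ x, f (f x) = x)
    (hf : ∀ x, f x = x ^ (2 ^ m)) : Nat.card {x : K // f x = x} = 2 ^ m := by
  classical
  have h2 : (2 : K) = 0 := CharTwo.two_eq_zero
  let T : K →+ K := f.toAddMonoidHom + AddMonoidHom.id K
  have hT : ∀ x, T x = f x + x := fun x => rfl
  have hker : Nat.card T.ker = Nat.card {x : K // f x = x} := by
    apply Nat.card_congr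
    refine Equiv.subtypeEquivRight fun x => ?_
    rw [AddMonoidHom.mem_ker, hT]; grind
  have hran : Nat.card T.range ≤ Nat.card {x : K // f x = x} := by
    refine Nat.card_le_card_of_injective
      (fun y => ⟨y.1, ?_⟩) (fun y z h => Subtype.ext (by simpa using h))
    obtain ⟨x, hx⟩ := y.2
    rw [← hx, hT, map_add, ff, add_comm]
  have hmul : Nat.card T.range * Nat.card T.ker = 2 ^ (2 * m) := by
    rw [← hK, ← Nat.card_eq_fintype_card, mul_comm, ← AddSubgroup.index_ker,
      AddSubgroup.card_mul_index]
  have hle : Nat.card {x : K // f x = x} ≤ 2 ^ m := by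
    have hq : 1 < 2 ^ m := Nat.one_lt_two_pow hm.ne'
    have hne := FiniteField.X_pow_card_sub_X_ne_zero K hq
    have hdeg := FiniteField.X_pow_card_sub_X_natDegree_eq K hq
    rw [Nat.card_eq_fintype_card, Fintype.card_subtype]
    have : (Finset.univ.filter fun x => f x = x) ⊆
        ((Polynomial.X ^ (2 ^ m) - Polynomial.X : Polynomial K)).roots.toFinset := by
      intro x hx
      simp only [Finset.mem_filter, Finset.mem_univ, true_and] at hx
      rw [Multiset.mem_toFinset, Polynomial.mem_roots hne]
      simp [Polynomial.IsRoot, ← hf, hx]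
    calc _ ≤ _ := Finset.card_le_card this
      _ ≤ _ := Multiset.toFinset_card_le _
      _ ≤ _ := Polynomial.card_roots' _
      _ = _ := hdeg
  rw [hker] at hmul
  have : 2 ^ (2 * m) = 2 ^ m * 2 ^ m := by rw [two_mul, pow_add]
  rw [this] at hmul
  apply le_antisymm hle
  by_contra hlt
  push Not at hlt
  nlinarith

theorem card_pairs {K : Type} [Field K] [Fintype K] [CharP K 2] (P : K → Prop) :
    Nat.card {ab : K × K // ab.1 * ab.2 * (ab.1 + ab.2) ≠ 0 ∧ P (ab.1 / ab.2)} =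
      Nat.card {c : K // (c ≠ 0 ∧ c ≠ 1) ∧ P c} * (Fintype.card K - 1) := by
  classical
  have h2 : (2 : K) = 0 := CharTwo.two_eq_zero
  rw [← Fintype.card_units, ← Nat.card_eq_fintype_card, ← Nat.card_prod]
  refine (Nat.card_congr (Equiv.ofBijective
    (fun p : {c : K // (c ≠ 0 ∧ c ≠ 1) ∧ P c} × Kˣ =>
      (⟨(p.1.1 * p.2.1, p.2.1), ?_, ?_⟩ :
        {ab : K × K // ab.1 * ab.2 * (ab.1 + ab.2) ≠ 0 ∧ P (ab.1 / ab.2)})) ⟨?_, ?_⟩)).symm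
  · obtain ⟨⟨c, ⟨h0, h1⟩, hP⟩, u⟩ := p
    have hu := u.ne_zero
    have : c * (u : K) + u = (c + 1) * u := by ring
    have hc : c + 1 ≠ 0 := by grind
    simp only [this]
    simp [h0, hu, hc]
  · obtain ⟨⟨c, ⟨h0, h1⟩, hP⟩, u⟩ := p
    simpa using hP
  · rintro ⟨⟨c, hc⟩, u⟩ ⟨⟨c', hc'⟩, u'⟩ h
    simp only [Subtype.mk.injEq, Prod.mk.injEq] at h
    obtain ⟨h1, h3⟩ := h
    have : u = u' := Units.ext h3
    subst this
    have : c = c' := mul_right_cancel₀ u.ne_zero h1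
    subst this
    rfl
  · rintro ⟨⟨a, b⟩, h, hP⟩
    simp only [ne_eq, mul_eq_zero, not_or] at h
    obtain ⟨⟨ha, hb⟩, hab⟩ := h
    refine ⟨(⟨a / b, ⟨div_ne_zero ha hb, ?_⟩, hP⟩, Units.mk0 b hb), ?_⟩
    · intro h
      rw [div_eq_one_iff_eq hb] at h
      grind
    · simp [hb]

/-- FBCT of a locally-APN Niho power function
`F(x) = x^(s(2^m-1)+1)` over `K = GF(2^(2m))`:
`FBCT_F(a,b) = 2^n` if `ab(a+b) = 0`; `= 2^m` if `ab(a+b) ≠ 0` and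
`a/b ∈ F_{2^m}`; `= 0` otherwise; together with the multiplicities of the
three cases. -/
theorem stmt_14 (m s : ℕ) (hm : 0 < m) (hs : 0 < s)
    (K : Type) [Field K] [Fintype K] (hK : Fintype.card K = 2 ^ (2 * m))
    (d : ℕ) (hd : d = s * (2 ^ m - 1) + 1)
    (hAPN : sSup {k : ℕ | ∃ b : K, b ^ 2 ≠ b ∧
        Nat.card {x : K // (x + 1) ^ d + x ^ d = b} = k} = 2) :
    (∀ a b : K, a * b * (a + b) = 0 →
      Nat.card {x : K // (x + a + b) ^ d + (x + a) ^ d + (x + b) ^ d + x ^ d = 0}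
        = 2 ^ (2 * m)) ∧
    (∀ a b : K, a * b * (a + b) ≠ 0 → (a / b) ^ (2 ^ m) = a / b →
      Nat.card {x : K // (x + a + b) ^ d + (x + a) ^ d + (x + b) ^ d + x ^ d = 0}
        = 2 ^ m) ∧
    (∀ a b : K, a * b * (a + b) ≠ 0 → (a / b) ^ (2 ^ m) ≠ a / b →
      Nat.card {x : K // (x + a + b) ^ d + (x + a) ^ d + (x + b) ^ d + x ^ d = 0}
        = 0) ∧
    Nat.card {ab : K × K // ab.1 * ab.2 * (ab.1 + ab.2) = 0}
      = 3 * 2 ^ (2 * m) - 2 ∧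
    Nat.card {ab : K × K // ab.1 * ab.2 * (ab.1 + ab.2) ≠ 0 ∧
        (ab.1 / ab.2) ^ (2 ^ m) = ab.1 / ab.2}
      = (2 ^ m - 2) * (2 ^ (2 * m) - 1) ∧
    Nat.card {ab : K × K // ab.1 * ab.2 * (ab.1 + ab.2) ≠ 0 ∧
        (ab.1 / ab.2) ^ (2 ^ m) ≠ ab.1 / ab.2}
      = (2 ^ (2 * m) - 2 ^ m) * (2 ^ (2 * m) - 1) := by
  classical
  have hq : 1 < 2 ^ m := Nat.one_lt_two_pow hm.ne'
  have qq : 2 ^ (2 * m) = 2 ^ m * 2 ^ m := by rw [two_mul, pow_add]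
  have : CharP K 2 := by
    have : Fact (Nat.Prime 2) := ⟨Nat.prime_two⟩
    exact charP_of_card_eq_prime_pow hK
  have h2 : (2 : K) = 0 := CharTwo.two_eq_zero
  obtain ⟨f, hf⟩ : ∃ f : K →+* K, ∀ x, f x = x ^ (2 ^ m) :=
    ⟨iterateFrobenius K 2 m, fun x => iterateFrobenius_def 2 m x⟩
  have ff : ∀ x, f (f x) = x := by
    intro x
    rw [hf, hf, ← pow_mul, ← qq, ← hK, FiniteField.pow_card]
  obtain ⟨r, hr⟩ : ∃ r, 2 ^ m = r + 1 := ⟨2 ^ m - 1, by omega⟩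
  have hd' : d = s * r + 1 := by rw [hd, hr]; simp
  have Fr : ∀ x : K, f x = x → x ^ d = x := by
    intro x hx
    rw [hd', pow_succ, mul_comm s, pow_mul]
    by_cases h0 : x = 0
    · simp [h0]
    · have : x ^ r = 1 := by
        rw [hf, hr, pow_succ] at hx
        exact mul_right_cancel₀ h0 (by rw [hx, one_mul])
      simp [this]
  have Fn : ∀ x : K, x ^ d * f (x ^ d) = x * f x := by
    intro x
    rw [map_pow, ← mul_pow]
    apply Fr
    rw [map_mul, ff, mul_comm]
  have Fmul : ∀ x y : K, (x * y) ^ d = x ^ d * y ^ d := fun x y => mul_pow x y d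
  have Ff : ∀ x : K, (f x) ^ d = f (x ^ d) := fun x => (map_pow f x d).symm
  have hbdd : BddAbove {k : ℕ | ∃ b : K, b ^ 2 ≠ b ∧
        Nat.card {x : K // (x + 1) ^ d + x ^ d = b} = k} := by
    refine ⟨Nat.card K, ?_⟩
    rintro k ⟨b, -, rfl⟩
    exact Nat.card_le_card_of_injective _ Subtype.val_injective
  have H : ∀ x y z : K, x ≠ y → y ≠ z → x ≠ z → (y + 1) ^ d + y ^ d = (x + 1) ^ d + x ^ d →
      (z + 1) ^ d + z ^ d = (x + 1) ^ d + x ^ d →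
      (x + 1) ^ d + x ^ d = 0 ∨ (x + 1) ^ d + x ^ d = 1 := by
    intro x y z hxy hyz hxz hy hz
    by_contra hcon
    push Not at hcon
    have hb : ((x + 1) ^ d + x ^ d) ^ 2 ≠ (x + 1) ^ d + x ^ d := by
      intro h
      rw [sq] at h
      exact hcon.2 (mul_right_cancel₀ hcon.1 (by rw [h, one_mul]))
    have hle := le_csSup hbdd ⟨_, hb, rfl⟩
    rw [hAPN, Nat.card_eq_fintype_card, Fintype.card_subtype] at hle
    have : ({x, y, z} : Finset K) ⊆
        Finset.univ.filter fun w => (w + 1) ^ d + w ^ d = (x + 1) ^ d + x ^ d := by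
      intro w hw
      simp only [Finset.mem_insert, Finset.mem_singleton] at hw
      rcases hw with rfl | rfl | rfl <;> simp [hy, hz]
    have := Finset.card_le_card this
    rw [Finset.card_eq_three.2 ⟨x, y, z, hxy, hxz, hyz, rfl⟩] at this
    omega
  have H2 : ∃ x : K, (x + 1) ^ d + x ^ d ≠ 1 := by
    have hne : {k : ℕ | ∃ b : K, b ^ 2 ≠ b ∧
        Nat.card {x : K // (x + 1) ^ d + x ^ d = b} = k}.Nonempty := by
      by_contra h
      rw [Set.not_nonempty_iff_eq_empty] at h
      rw [h] at hAPN
      simp at hAPN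
    have hmem := Nat.sSup_mem hne hbdd
    rw [hAPN] at hmem
    obtain ⟨b, hb, hc⟩ := hmem
    have : Nonempty {x : K // (x + 1) ^ d + x ^ d = b} := by
      by_contra h
      rw [not_nonempty_iff] at h
      rw [Nat.card_of_isEmpty] at hc
      omega
    obtain ⟨x, hx⟩ := this
    refine ⟨x, ?_⟩
    rw [hx]
    rintro rfl
    simp at hb
  have M := aux_main_s14 f ff (fun x => x ^ d) Fmul Ff Fn Fr H H2
  have S : ∀ a b : K, a * b * (a + b) ≠ 0 → ∀ x : K,
      (x + a + b) ^ d + (x + a) ^ d + (x + b) ^ d + x ^ d = 0 ↔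
        f (x / b) = x / b ∧ f (a / b) = a / b := by
    intro a b h x
    simp only [ne_eq, mul_eq_zero, not_or] at h
    obtain ⟨⟨ha, hb⟩, hab⟩ := h
    rw [← M (a / b) (x / b) (div_ne_zero ha hb) (by
      intro h
      rw [div_eq_one_iff_eq hb] at h
      grind)]
    have e1 : x / b + a / b + 1 = (x + a + b) / b := by field_simp
    have e2 : x / b + a / b = (x + a) / b := by field_simp
    have e3 : x / b + 1 = (x + b) / b := by field_simp
    have hbd : b ^ d ≠ 0 := pow_ne_zero _ hb
    simp only [e1]
    simp only [e2, e3, div_pow]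
    rw [← add_div, ← add_div, div_left_inj' hbd]
    constructor <;> intro h <;> grind
  have hfix := card_fix m hm hK f ff hf
  have C2 : Nat.card {c : K // (c ≠ 0 ∧ c ≠ 1) ∧ c ^ (2 ^ m) = c} = 2 ^ m - 2 := by
    have hfix' := hfix
    rw [Nat.card_eq_fintype_card, Fintype.card_subtype] at hfix'
    rw [Nat.card_eq_fintype_card, Fintype.card_subtype]
    have : (Finset.univ.filter fun c : K => (c ≠ 0 ∧ c ≠ 1) ∧ c ^ (2 ^ m) = c) =
        (Finset.univ.filter fun c : K => f c = c) \ {0, 1} := by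
      ext c
      simp [hf]
      tauto
    rw [this, Finset.card_sdiff_of_subset, Finset.card_pair zero_ne_one, hfix']
    intro c hc
    simp only [Finset.mem_insert, Finset.mem_singleton] at hc
    rcases hc with rfl | rfl <;> simp
  have C3 : Nat.card {c : K // (c ≠ 0 ∧ c ≠ 1) ∧ c ^ (2 ^ m) ≠ c} = 2 ^ (2 * m) - 2 ^ m := by
    have e : ∀ c : K, ((c ≠ 0 ∧ c ≠ 1) ∧ c ^ (2 ^ m) ≠ c) ↔ ¬ f c = c := by
      intro c
      rw [hf]
      constructor
      · exact fun h => h.2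
      · intro h
        refine ⟨⟨?_, ?_⟩, h⟩
        · rintro rfl; simp at h
        · rintro rfl; simp at h
    rw [Nat.card_congr (Equiv.subtypeEquivRight e), Nat.card_eq_fintype_card,
      Fintype.card_subtype_compl, hK, ← Nat.card_eq_fintype_card, hfix]
  have P2 := card_pairs (K := K) (fun c => c ^ (2 ^ m) = c)
  have P3 := card_pairs (K := K) (fun c => c ^ (2 ^ m) ≠ c)
  have P1 := card_pairs (K := K) (fun _ => True)
  rw [C2, hK] at P2
  rw [C3, hK] at P3
  refine ⟨?_, ?_, ?_, ?_, P2, P3⟩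
  · intro a b h
    rw [← hK, ← Nat.card_eq_fintype_card]
    apply Nat.card_congr
    refine Equiv.subtypeUnivEquiv fun x => ?_
    rcases mul_eq_zero.1 h with h | h
    · rcases mul_eq_zero.1 h with h | h <;> subst h <;> simp only [add_zero] <;> grind
    · have : a = b := by grind
      subst this
      have : x + a + a = x := by grind
      rw [this]; grind
  · intro a b h hab
    rw [← hfix]
    have hb : b ≠ 0 := by rintro rfl; simp at h
    apply Nat.card_congr
    refine Equiv.subtypeEquiv (Equiv.divRight₀ b hb) fun x => ?_
    rw [S a b h x, hf (a / b)]
    simp [hab]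
  · intro a b h hab
    rw [Nat.card_eq_zero]
    left
    refine ⟨fun x => hab ?_⟩
    have := ((S a b h x.1).1 x.2).2
    rwa [hf] at this
  · have C1 : Nat.card {c : K // (c ≠ 0 ∧ c ≠ 1) ∧ True} = 2 ^ (2 * m) - 2 := by
      rw [← hK, Nat.card_eq_fintype_card, Fintype.card_subtype]
      have : (Finset.univ.filter fun c : K => (c ≠ 0 ∧ c ≠ 1) ∧ True) =
          Finset.univ \ {0, 1} := by
        ext c
        simp
      rw [this, Finset.card_sdiff_of_subset (Finset.subset_univ _),
        Finset.card_pair zero_ne_one, Finset.card_univ]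
    simp only [and_true] at P1 C1
    rw [C1, hK, Nat.card_eq_fintype_card] at P1
    have hc := Fintype.card_subtype_compl
      (fun ab : K × K => ¬ (ab.1 * ab.2 * (ab.1 + ab.2) = 0))
    simp only [not_not] at hc
    simp only [ne_eq] at P1
    rw [Nat.card_eq_fintype_card, hc, P1, Fintype.card_prod, hK]
    obtain ⟨k, hk⟩ : ∃ k, 2 ^ (2 * m) = k + 2 := ⟨2 ^ (2 * m) - 2, by nlinarith [Nat.sub_add_cancel (show 2 ≤ 2 ^ (2 * m) by nlinarith)]⟩
    rw [hk]
    have e1 : k + 2 - 2 = k := by omega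
    have e2 : k + 2 - 1 = k + 1 := by omega
    rw [e1, e2]
    have : (k + 2) * (k + 2) = k * (k + 1) + (3 * (k + 2) - 2) := by
      have : 3 * (k + 2) - 2 = 3 * k + 4 := by omega
      rw [this]; ring
    omega
end

section
/- Assume p = 2, m ≥ 2, and that F is locally-APN. Then the Feistel boomerang uniformity of F equals 2^m; that is, max{FBCT_F(a,b) : a, b ∈ K, a·b·(a+b) ≠ 0} = 2^m. -/
theorem aux_card (m : ℕ) (hm : 2 ≤ m) (K : Type) [Field K] [Fintype K]
    (hK : Fintype.card K = 2 ^ (2 * m)) :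
    Nat.card {x : K // x ^ (2 ^ m) = x} = 2 ^ m := by
  classical
  have hq : 4 ≤ 2 ^ m := by
    calc 4 = 2 ^ 2 := by norm_num
      _ ≤ 2 ^ m := Nat.pow_le_pow_right (by norm_num) hm
  have hcu : Nat.card Kˣ = (2 ^ m - 1) * (2 ^ m + 1) := by
    rw [Nat.card_eq_fintype_card, Fintype.card_units, hK, mul_comm 2 m, pow_mul]
    obtain ⟨k, hk⟩ := Nat.exists_eq_add_of_le hq
    rw [hk]
    have : (4 + k) ^ 2 = (4 + k - 1) * (4 + k + 1) + 1 := by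
      have : 4 + k - 1 = 3 + k := by omega
      rw [this]; ring
    omega
  have h1 : Nat.card (powMonoidHom (2 ^ m - 1) : Kˣ →* Kˣ).ker = 2 ^ m - 1 := by
    rw [IsCyclic.card_powMonoidHom_ker, hcu]
    exact Nat.gcd_eq_right (Dvd.intro _ rfl)
  have e : {x : K // x ^ (2 ^ m) = x} ≃ Option (powMonoidHom (2 ^ m - 1) : Kˣ →* Kˣ).ker := by
    refine
      { toFun := fun x => if h : x.1 = 0 then none else
          some ⟨Units.mk0 x.1 h, ?_⟩
        invFun := fun o => match o with
          | none => ⟨0, by simp⟩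
          | some u => ⟨(u.1 : K), ?_⟩
        left_inv := ?_
        right_inv := ?_ }
    · rw [MonoidHom.mem_ker]
      ext
      simp only [powMonoidHom_apply, Units.val_pow_eq_pow_val, Units.val_mk0, Units.val_one]
      have := x.2
      apply mul_right_cancel₀ h
      rw [← pow_succ, Nat.sub_add_cancel (by omega), this, one_mul]
    · have h := u.2
      rw [MonoidHom.mem_ker] at h
      have h' : ((u.1 : Kˣ) : K) ^ (2 ^ m - 1) = 1 := by
        have := congrArg Units.val h
        simpa using this
      have gen : ∀ t : K, t ^ (2 ^ m - 1) = 1 → t ^ 2 ^ m = t := by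
        intro t ht
        have hs : 2 ^ m = 2 ^ m - 1 + 1 := by omega
        rw [hs, pow_succ, ht, one_mul]
      exact gen _ h'
    · intro x
      by_cases h : x.1 = 0
      · simp only [h, dite_true]; exact Subtype.ext h.symm
      · simp [h]
    · rintro (_ | u)
      · simp
      · simp
  rw [Nat.card_congr e, Nat.card_eq_fintype_card, Fintype.card_option,
    ← Nat.card_eq_fintype_card, h1]
  omega

theorem aux_main_s15 (m s : ℕ) (hm : 2 ≤ m)
    (K : Type) [Field K] [Fintype K] [CharP K 2] (σ : K →+* K) (F : K →* K)
    (hσσ : ∀ x, σ (σ x) = x) (hF0 : F 0 = 0)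
    (hFσ : ∀ x, F (σ x) = σ (F x)) (hfix : ∀ x, σ x = x → F x = x)
    (hapn : ∀ x y, F (x + 1) + F x = F (y + 1) + F y →
      (F (x + 1) + F x) ^ 2 ≠ F (x + 1) + F x → y = x ∨ y = x + 1)
    (hex : ∃ x, (F (x + 1) + F x) ^ 2 ≠ F (x + 1) + F x) :
    (∀ b y, b ≠ 0 → b ≠ 1 → F (y + b + 1) + F (y + b) = F (y + 1) + F y →
      σ b = b ∧ σ y = y) := by
  have h2 : (2 : K) = 0 := CharTwo.two_eq_zero
  have add0 : ∀ x y : K, x + y = 0 → x = y := fun x y h => CharTwo.add_eq_zero.mp h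
  have sq01 : ∀ c : K, c ≠ 0 → c ≠ 1 → c ^ 2 ≠ c := by
    intro c h0 h1 h
    apply h1
    apply mul_left_cancel₀ h0
    linear_combination h
  have apnA : ∀ a x y, a ≠ 0 → F (x + a) + F x = F (y + a) + F y →
      F (x + a) + F x ≠ 0 → F (x + a) + F x ≠ F a → y = x ∨ y = x + a := by
    intro a x y ha h h0 h1
    have hFa : F a ≠ 0 := by
      have := (IsUnit.mk0 a ha).map F
      exact this.ne_zero
    have key : ∀ t, F (t / a + 1) + F (t / a) = (F (t + a) + F t) / F a := by
      intro t
      have e1 : F (t + a) = F (t / a + 1) * F a := by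
        rw [← map_mul]; congr 1; field_simp
      have e2 : F t = F (t / a) * F a := by
        rw [← map_mul]; congr 1; field_simp
      rw [e1, e2]; field_simp
    have := hapn (x / a) (y / a) (by rw [key, key, h]) (by
      rw [key]
      apply sq01
      · exact div_ne_zero h0 hFa
      · intro h; apply h1; rwa [div_eq_one_iff_eq hFa] at h)
    rcases this with h | h
    · left; field_simp at h; exact h
    · right; field_simp at h; exact h
  have claim1 : ∀ φ : K →+* K, (∀ x, σ x = x → φ x = x) → (∃ a, F a ≠ φ a) →
      ∀ x, F x = φ x → σ x = x := by
    rintro φ hφ ⟨a, ha⟩ x hx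
    by_contra hne
    have hT : σ x + x ≠ 0 := fun h => hne (add0 _ _ h)
    have hTa : σ a + a ≠ 0 := by
      intro h
      have := add0 _ _ h
      exact ha (by rw [hfix a this, hφ a this])
    have ha0 : a ≠ 0 := by rintro rfl; simp at hTa
    have hx0 : x ≠ 0 := by rintro rfl; simp at hT
    have hc : ∀ t, σ (σ t + t) = σ t + t := by
      intro t; rw [map_add, hσσ, add_comm]
    set c := (σ a + a) / (σ x + x) with hcdef
    have hcx : c * (σ x + x) = σ a + a := by rw [hcdef]; field_simp
    set e := (σ a + a) / (σ x + x) ^ 2 with hedef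
    have hex' : e * (σ x + x) ^ 2 = σ a + a := by rw [hedef]; field_simp
    have hσc : σ c = c := by rw [hcdef, map_div₀, hc, hc]
    have hσe : σ e = e := by rw [hedef, map_div₀, map_pow, hc, hc]
    have f1 : F (c * x) = φ (c * x) := by
      rw [map_mul, map_mul, hx, hfix c hσc, hφ c hσc]
    have f2 : F (e * x ^ 2) = φ (e * x ^ 2) := by
      rw [map_mul, map_mul, map_pow, map_pow, hx, hfix e hσe, hφ e hσe]
    have g1 : σ (c * x + a) = c * x + a := by
      rw [map_add, map_mul, hσc]
      linear_combination hcx + (σ a - c * x) * h2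
    have g2 : σ (e * x ^ 2 + a) = e * x ^ 2 + a := by
      rw [map_add, map_mul, map_pow, hσe]
      linear_combination hex' + (σ a - e * x ^ 2 - e * x * σ x) * h2
    have s1 : F (c * x + a) + F (c * x) = φ a := by
      rw [f1, hfix _ g1, ← hφ _ g1, map_add]
      linear_combination (φ (c * x)) * h2
    have s2 : F (e * x ^ 2 + a) + F (e * x ^ 2) = φ a := by
      rw [f2, hfix _ g2, ← hφ _ g2, map_add]
      linear_combination (φ (e * x ^ 2)) * h2
    have he0 : e ≠ 0 := div_ne_zero hTa (pow_ne_zero _ hT)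
    rcases apnA a (c * x) (e * x ^ 2) ha0 (by rw [s1, s2])
      (by rw [s1]; exact (map_ne_zero φ).2 ha0) (by rw [s1]; exact ha.symm) with h | h
    · have hce : c = e * (σ x + x) := by rw [hcdef, hedef]; field_simp
      have : e * x * σ x = 0 := by
        rw [hce] at h
        linear_combination -h
      have hsx : σ x ≠ 0 := (map_ne_zero σ).2 hx0
      exact mul_ne_zero (mul_ne_zero he0 hx0) hsx this
    · rw [← h, map_mul, map_pow, hσe] at g1
      have : σ x ^ 2 = x ^ 2 := mul_left_cancel₀ he0 g1
      apply hT
      have : (σ x + x) ^ 2 = 0 := by linear_combination this + (x ^ 2 + x * σ x) * h2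
      exact pow_eq_zero_iff (two_ne_zero) |>.1 this
  have hid : ∃ a, F a ≠ a := by
    by_contra! h
    obtain ⟨x, hx⟩ := hex
    apply hx
    have : F (x + 1) + F x = 1 := by rw [h, h]; linear_combination x * h2
    rw [this]; ring
  have hsg : ∃ a, F a ≠ σ a := by
    by_contra! h
    obtain ⟨x, hx⟩ := hex
    apply hx
    have : F (x + 1) + F x = 1 := by
      rw [h, h, map_add, map_one]; linear_combination σ x * h2
    rw [this]; ring
  have c1 := claim1 (RingHom.id K) (fun x _ => rfl) hid
  have c2 := claim1 σ (fun x h => h) hsg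
  have hN : ∀ x, F x * σ (F x) = x * σ x := by
    intro x
    rw [← hFσ, ← map_mul]
    apply hfix
    rw [map_mul, hσσ, mul_comm]
  have D1 : ∀ x, F (x + 1) + F x = 1 → σ x = x := by
    intro x h
    have n1 := hN x
    have n2 := hN (x + 1)
    have hY : F (x + 1) = F x + 1 := by linear_combination h - F x * h2
    rw [hY] at n2
    simp only [map_add, map_one] at n2
    have : (F x - x) * (F x - σ x) = 0 := by
      linear_combination (F x - 1) * n1 - F x * n2 + (F x ^ 2 - F x * x - F x * σ x + F x * σ (F x)) * h2
    rcases mul_eq_zero.1 this with h | h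
    · exact c1 x (sub_eq_zero.1 h)
    · exact c2 x (sub_eq_zero.1 h)
  have D0 : ∀ x, F (x + 1) + F x = 0 → σ x = x + 1 ∧ σ (F x) = F x ∧ F x ^ 2 = x * σ x := by
    intro x h
    have n1 := hN x
    have n2 := hN (x + 1)
    have hY := add0 _ _ h
    rw [hY] at n2
    simp only [map_add, map_one] at n2
    have e1 : σ x = x + 1 := by linear_combination n1 - n2 + (0 - x - 1) * h2
    have e2 : σ (F x) = F x := by rw [← hFσ, e1, hY]
    refine ⟨e1, e2, ?_⟩
    rw [e2] at n1; rw [← n1]; ring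
  intro b y hb0 hb1 h
  have hc01 : F (y + 1) + F y = 0 ∨ F (y + 1) + F y = 1 := by
    by_contra! hcon
    rcases hapn y (y + b) (by rw [h]) (sq01 _ hcon.1 hcon.2) with h' | h'
    · exact hb0 (by linear_combination h')
    · exact hb1 (by linear_combination h')
  rcases hc01 with hc | hc
  · exfalso
    rw [hc] at h
    obtain ⟨u1, u2, u3⟩ := D0 _ hc
    obtain ⟨v1, v2, v3⟩ := D0 _ h
    have hσb : σ b = b := by
      rw [map_add, u1] at v1; linear_combination v1
    have hσi : σ b⁻¹ = b⁻¹ := by rw [map_inv₀, hσb]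
    have hbi : b⁻¹ * b = 1 := inv_mul_cancel₀ hb0
    have t1 : F (b⁻¹ * y) = b⁻¹ * F y := by rw [map_mul, hfix _ hσi]
    have t2 : F (b⁻¹ * y + 1) = b⁻¹ * F (y + b) := by
      rw [← hfix _ hσi, ← map_mul, hfix _ hσi]; congr 1; linear_combination - hbi
    have hσt : σ (b⁻¹ * y) = b⁻¹ * y + b⁻¹ := by rw [map_mul, hσi, u1]; ring
    have hsq : (F (b⁻¹ * y + 1) + F (b⁻¹ * y)) ^ 2 = b⁻¹ + 1 := by
      rw [t1, t2]
      rw [v1] at v3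
      rw [u1] at u3
      linear_combination (b⁻¹)^2 * v3 + (b⁻¹)^2 * u3 + (b⁻¹ * b + 1 + b⁻¹) * hbi
        + ((b⁻¹)^2 * (F y * F (y+b) + y^2 + y + y * b)) * h2
    have hfixD : σ (F (b⁻¹ * y + 1) + F (b⁻¹ * y)) = F (b⁻¹ * y + 1) + F (b⁻¹ * y) := by
      rw [t1, t2, map_add, map_mul, map_mul, hσi, u2, v2]
    have hD : F (b⁻¹ * y + 1) + F (b⁻¹ * y) = F (σ (b⁻¹ * y) + 1) + F (σ (b⁻¹ * y)) := by
      rw [← hfixD, map_add, ← hFσ, ← hFσ, map_add, map_one]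
    have hbi0 : b⁻¹ ≠ 0 := inv_ne_zero hb0
    have hbi1 : b⁻¹ ≠ 1 := by simpa using hb1
    rcases hapn _ _ hD (sq01 _ (by
        intro h; rw [h] at hsq
        exact hbi1 (add0 _ _ (by rw [← hsq]; ring)))
      (by
        intro h; rw [h] at hsq
        exact hbi0 (by linear_combination -hsq))) with h' | h'
    · rw [hσt] at h'; exact hbi0 (by linear_combination h')
    · rw [hσt] at h'; exact hbi1 (by linear_combination h')
  · rw [hc] at h
    have a1 := D1 _ hc
    have a2 := D1 _ h
    refine ⟨?_, a1⟩
    rw [map_add, a1] at a2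
    exact add_left_cancel a2

/-- for `m ≥ 2`, the Feistel boomerang uniformity of a
locally-APN Niho power function `F(x) = x^(s(2^m-1)+1)` over `K = GF(2^(2m))`
equals `2^m`: `max{FBCT_F(a,b) : ab(a+b) ≠ 0} = 2^m`. -/
theorem stmt_15 (m s : ℕ) (hm : 2 ≤ m) (hs : 0 < s)
    (K : Type) [Field K] [Fintype K] (hK : Fintype.card K = 2 ^ (2 * m))
    (d : ℕ) (hd : d = s * (2 ^ m - 1) + 1)
    (hAPN : sSup {k : ℕ | ∃ b : K, b ^ 2 ≠ b ∧
        Nat.card {x : K // (x + 1) ^ d + x ^ d = b} = k} = 2) :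
    sSup {k : ℕ | ∃ a b : K, a * b * (a + b) ≠ 0 ∧
        Nat.card {x : K // (x + a + b) ^ d + (x + a) ^ d + (x + b) ^ d + x ^ d = 0}
          = k} = 2 ^ m := by
  classical
  haveI : Fact (Nat.Prime 2) := ⟨Nat.prime_two⟩
  haveI hchar : CharP K 2 := by
    obtain ⟨p, hp⟩ := CharP.exists K
    obtain ⟨n, hpp, hn⟩ := FiniteField.card K p
    rw [hK] at hn
    have : p ∣ 2 ^ (2 * m) := by rw [hn]; exact dvd_pow_self p n.2.ne'
    have := (Nat.prime_dvd_prime_iff_eq hpp Nat.prime_two).1 (hpp.dvd_of_dvd_pow this)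
    rwa [this] at hp
  have h2 : (2 : K) = 0 := CharTwo.two_eq_zero
  have add0 : ∀ x y : K, x + y = 0 → x = y := fun x y h => CharTwo.add_eq_zero.mp h
  have hcard := aux_card m hm K hK
  have hq : 4 ≤ 2 ^ m := by
    calc 4 = 2 ^ 2 := by norm_num
      _ ≤ 2 ^ m := Nat.pow_le_pow_right (by norm_num) hm
  have hbdd : BddAbove {k : ℕ | ∃ b : K, b ^ 2 ≠ b ∧
        Nat.card {x : K // (x + 1) ^ d + x ^ d = b} = k} := by
    refine ⟨Nat.card K, ?_⟩
    rintro k ⟨b, _, rfl⟩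
    exact Nat.card_le_card_of_injective _ Subtype.val_injective
  have hne : {k : ℕ | ∃ b : K, b ^ 2 ≠ b ∧
        Nat.card {x : K // (x + 1) ^ d + x ^ d = b} = k}.Nonempty := by
    rw [Set.nonempty_iff_ne_empty]
    intro h
    rw [h] at hAPN
    simp at hAPN
  have hex : ∃ x : K, ((x + 1) ^ d + x ^ d) ^ 2 ≠ (x + 1) ^ d + x ^ d := by
    have := Nat.sSup_mem hne hbdd
    rw [hAPN] at this
    obtain ⟨b, hb, hc⟩ := this
    have : Nonempty {x : K // (x + 1) ^ d + x ^ d = b} := by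
      by_contra h
      rw [not_nonempty_iff] at h
      rw [Nat.card_of_isEmpty] at hc
      omega
    obtain ⟨x, hx⟩ := this
    exact ⟨x, by rwa [hx]⟩
  have hapn : ∀ x y : K, (x + 1) ^ d + x ^ d = (y + 1) ^ d + y ^ d →
      ((x + 1) ^ d + x ^ d) ^ 2 ≠ (x + 1) ^ d + x ^ d → y = x ∨ y = x + 1 := by
    intro x y hxy hb
    by_contra! hcon
    have h1 : Nat.card {t : K // (t + 1) ^ d + t ^ d = (x + 1) ^ d + x ^ d} ≤ 2 := by
      rw [← hAPN]
      exact le_csSup hbdd ⟨_, hb, rfl⟩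
    have h3 : ({x, x + 1, y} : Finset K).card = 3 := by
      rw [Finset.card_eq_three]
      refine ⟨x, x + 1, y, ?_, hcon.1.symm, hcon.2.symm, rfl⟩
      simp
    have hsub : ({x, x + 1, y} : Finset K) ⊆
        Finset.univ.filter (fun t : K => (t + 1) ^ d + t ^ d = (x + 1) ^ d + x ^ d) := by
      intro t ht
      simp only [Finset.mem_insert, Finset.mem_singleton] at ht
      simp only [Finset.mem_filter, Finset.mem_univ, true_and]
      rcases ht with rfl | rfl | rfl
      · rfl
      · have : x + 1 + 1 = x := by linear_combination h2
        rw [this, add_comm]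
      · exact hxy.symm
    have := Finset.card_le_card hsub
    rw [h3, ← Fintype.card_subtype, ← Nat.card_eq_fintype_card] at this
    omega
  have hd0 : d ≠ 0 := by omega
  have hσ : ∀ x : K, iterateFrobenius K 2 m x = x ^ 2 ^ m := fun x => iterateFrobenius_def 2 m x
  have main := aux_main_s15 m s hm K (iterateFrobenius K 2 m) (powMonoidHom d)
    (by
      intro x
      rw [hσ, hσ, ← pow_mul, ← pow_add, ← two_mul, ← hK, FiniteField.pow_card])
    (by simp [hd0])
    (by intro x; simp only [powMonoidHom_apply, map_pow])
    (by
      intro x hx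
      rw [hσ] at hx
      rw [powMonoidHom_apply]
      by_cases h0 : x = 0
      · rw [h0, zero_pow hd0]
      have : x ^ (2 ^ m - 1) = 1 := by
        apply mul_right_cancel₀ h0
        rw [← pow_succ, Nat.sub_add_cancel (by omega), hx, one_mul]
      rw [hd, pow_succ, mul_comm s, pow_mul, this, one_pow, one_mul])
    hapn hex
  simp only [powMonoidHom_apply, hσ] at main
  have hfixd : ∀ x : K, x ^ 2 ^ m = x → x ^ d = x := by
    intro x hx
    by_cases h0 : x = 0
    · rw [h0, zero_pow hd0]
    have : x ^ (2 ^ m - 1) = 1 := by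
      apply mul_right_cancel₀ h0
      rw [← pow_succ, Nat.sub_add_cancel (by omega), hx, one_mul]
    rw [hd, pow_succ, mul_comm s, pow_mul, this, one_pow, one_mul]
  have hscale : ∀ a b x : K, a * b * (a + b) ≠ 0 →
      (x + a + b) ^ d + (x + a) ^ d + (x + b) ^ d + x ^ d = 0 →
      (x / a) ^ 2 ^ m = x / a := by
    intro a b x hab hx
    have ha : a ≠ 0 := by rintro rfl; simp at hab
    have hb : b ≠ 0 := by rintro rfl; simp at hab
    have hs : a + b ≠ 0 := by intro h; rw [h] at hab; simp at hab
    refine (main (b / a) (x / a) (div_ne_zero hb ha) ?_ ?_).2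
    · intro h
      rw [div_eq_one_iff_eq ha] at h
      apply hs; rw [h]; linear_combination a * h2
    · have e1 : x / a + b / a + 1 = (x + a + b) / a := by field_simp; ring
      have e2 : x / a + b / a = (x + b) / a := by field_simp
      have e3 : x / a + 1 = (x + a) / a := by field_simp
      rw [e1, e2, e3]
      simp only [div_pow]
      apply add0
      rw [← add_div, ← add_div, ← add_div, div_eq_zero_iff]
      left
      rw [← hx]; ring
  apply le_antisymm
  · apply csSup_le'
    rintro k ⟨a, b, hab, rfl⟩
    rw [← hcard]
    have ha : a ≠ 0 := by rintro rfl; simp at hab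
    refine Nat.card_le_card_of_injective
      (fun x => ⟨x.1 / a, hscale a b x.1 hab x.2⟩) ?_
    intro x y hxy
    have h := congrArg Subtype.val hxy
    simp only at h
    apply Subtype.ext
    field_simp at h
    exact h
  · have hbdd' : BddAbove {k : ℕ | ∃ a b : K, a * b * (a + b) ≠ 0 ∧
        Nat.card {x : K // (x + a + b) ^ d + (x + a) ^ d + (x + b) ^ d + x ^ d = 0}
          = k} := by
      refine ⟨Nat.card K, ?_⟩
      rintro k ⟨a, b, _, rfl⟩
      exact Nat.card_le_card_of_injective _ Subtype.val_injective
    have hb : ∃ b : K, b ^ 2 ^ m = b ∧ b ≠ 0 ∧ b ≠ 1 := by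
      by_contra! h
      have : Finset.univ.filter (fun t : K => t ^ 2 ^ m = t) ⊆ {0, 1} := by
        intro t ht
        simp only [Finset.mem_filter, Finset.mem_univ, true_and] at ht
        simp only [Finset.mem_insert, Finset.mem_singleton]
        by_cases h0 : t = 0
        · exact Or.inl h0
        · exact Or.inr (h t ht h0)
      have := (Finset.card_le_card this).trans Finset.card_le_two
      rw [← Fintype.card_subtype, ← Nat.card_eq_fintype_card, hcard] at this
      omega
    obtain ⟨b, hbq, hb0, hb1⟩ := hb
    have hb1' : (1 : K) * b * (1 + b) ≠ 0 := by
      rw [one_mul]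
      refine mul_ne_zero hb0 ?_
      intro h
      exact hb1 (add0 _ _ h).symm
    refine le_trans ?_ (le_csSup hbdd' ⟨1, b, hb1', rfl⟩)
    conv_lhs => rw [← hcard]
    refine Nat.card_le_card_of_injective (fun x => ⟨x.1, ?_⟩) ?_
    · have hx := x.2
      have hadd : ∀ u v : K, u ^ 2 ^ m = u → v ^ 2 ^ m = v → (u + v) ^ 2 ^ m = u + v := by
        intro u v hu hv
        rw [← hσ, map_add, hσ, hσ, hu, hv]
      have h1 : (1 : K) ^ 2 ^ m = 1 := one_pow _
      rw [hfixd _ (hadd _ _ (hadd _ _ hx h1) hbq), hfixd _ (hadd _ _ hx h1),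
        hfixd _ (hadd _ _ hx hbq), hfixd _ hx]
      linear_combination (2 * x.1 + 1 + b) * h2
    · intro x y hxy
      have h := congrArg Subtype.val hxy
      exact Subtype.ext h
end
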